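/- arXiv:0711.2749 — 9 statements merged into one kernel-verified Lean document; each statement's English description precedes it below -/
import Mathlib

section
/- For every integer i ≥ 2, there exists a position P on the board Rhombus(6i) from which a sweep of length (9i−1)(3i−1) is legal, such that the complement position B \ P can be reduced, by a sequence of exactly 9i−1 moves, to a position consisting of a single peg located at a corner of the board. -/
/-- The six jump directions on the triangular lattice (oblique coordinates). -/
def Dirs : Finset (ℤ × ℤ) := {(1,0), (-1,0), (0,1), (0,-1), (1,1), (-1,-1)}

/-- The rhombus board of side `n`: `{0,…,n−1} × {0,…,n−1}`. -/
noncomputable def Rhombus (n : ℕ) : Finset (ℤ × ℤ) :=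
  Finset.Icc (0 : ℤ) ((n : ℤ) - 1) ×ˢ Finset.Icc (0 : ℤ) ((n : ℤ) - 1)

/-- A jump in position `P` on board `B`: peg at `p`, direction `d ∈ Dirs`,
peg at `p+d`, empty board hole at `p+2d`. -/
def JumpOK (B P : Finset (ℤ × ℤ)) (p d : ℤ × ℤ) : Prop :=
  d ∈ Dirs ∧ p ∈ P ∧ p + d ∈ P ∧ p + d + d ∈ B ∧ p + d + d ∉ P

/-- The position resulting from the jump `(p, d)` in position `P`. -/
def jumpResult (P : Finset (ℤ × ℤ)) (p d : ℤ × ℤ) : Finset (ℤ × ℤ) :=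
  (P \ {p, p + d}) ∪ {p + d + d}

/-- `SweepFrom B P s ds e Q`: starting in position `P`, the peg at `s` makes the
consecutive jumps with directions `ds` (each jump starting where the previous landed),
ending at hole `e` and producing position `Q`.  A move is such a sweep with `ds ≠ []`;
its length (number of pegs captured) is `ds.length`. -/
inductive SweepFrom (B : Finset (ℤ × ℤ)) :
    Finset (ℤ × ℤ) → ℤ × ℤ → List (ℤ × ℤ) → ℤ × ℤ → Finset (ℤ × ℤ) → Prop
  | nil (P : Finset (ℤ × ℤ)) (s : ℤ × ℤ) : SweepFrom B P s [] s P
  | cons {P : Finset (ℤ × ℤ)} {s d e : ℤ × ℤ} {ds : List (ℤ × ℤ)} {Q : Finset (ℤ × ℤ)} :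
      JumpOK B P s d → SweepFrom B (jumpResult P s d) (s + d + d) ds e Q →
      SweepFrom B P s (d :: ds) e Q

/-- A move is recorded as a pair (starting hole, nonempty list of jump directions).
`PlayMove B P m Q` says the move `m` is legal in position `P` and produces `Q`. -/
def PlayMove (B P : Finset (ℤ × ℤ)) (m : (ℤ × ℤ) × List (ℤ × ℤ))
    (Q : Finset (ℤ × ℤ)) : Prop :=
  m.2 ≠ [] ∧ ∃ e, SweepFrom B P m.1 m.2 e Q

/-- `Plays B P ms Q`: the finite sequence of moves `ms` leads from position `P`
to position `Q` on board `B`. -/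
inductive Plays (B : Finset (ℤ × ℤ)) :
    Finset (ℤ × ℤ) → List ((ℤ × ℤ) × List (ℤ × ℤ)) → Finset (ℤ × ℤ) → Prop
  | nil (P : Finset (ℤ × ℤ)) : Plays B P [] P
  | cons {P Q R : Finset (ℤ × ℤ)} {m : (ℤ × ℤ) × List (ℤ × ℤ)}
      {ms : List ((ℤ × ℤ) × List (ℤ × ℤ))} :
      PlayMove B P m Q → Plays B Q ms R → Plays B P (m :: ms) R

/-- The list of all holes touched by a sweep starting at `s` with directions `ds`:
every starting hole, every jumped-over hole and every landing hole. -/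
def sweepHoles (s : ℤ × ℤ) : List (ℤ × ℤ) → List (ℤ × ℤ)
  | [] => [s]
  | d :: ds => s :: (s + d) :: sweepHoles (s + d + d) ds

/-- The hole where a sweep starting at `s` with directions `ds` ends. -/
def sweepEnd (s : ℤ × ℤ) : List (ℤ × ℤ) → ℤ × ℤ
  | [] => s
  | d :: ds => sweepEnd (s + d + d) ds

/-- A single jump as a step relation between positions on board `B`. -/
def JumpStep (B P Q : Finset (ℤ × ℤ)) : Prop :=
  ∃ p d, JumpOK B P p d ∧ Q = jumpResult P p d

/-- The position `P` consists of exactly the holes satisfying `φ`. -/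
def Describes (P : Finset (ℤ × ℤ)) (φ : ℤ → ℤ → Prop) : Prop :=
  ∀ u v : ℤ, (u, v) ∈ P ↔ φ u v

/-- On `Rhombus n`, in the position described by `φ` the peg at `(x, y)` can make `k` consecutive
jumps that end at `(x', y')` and produce the position described by `ψ`. -/
def Sweeps (n : ℕ) (φ : ℤ → ℤ → Prop) (x y : ℤ) (k : ℕ) (x' y' : ℤ) (ψ : ℤ → ℤ → Prop) : Prop :=
  ∀ P, Describes P φ → ∃ ds Q, ds.length = k ∧
    SweepFrom (Rhombus n) P (x, y) ds (x', y') Q ∧ Describes Q ψ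

/-- On `Rhombus n`, exactly `k` moves can lead from the position described by `φ` to the position
described by `ψ`. -/
def Reduces (n : ℕ) (φ : ℤ → ℤ → Prop) (k : ℕ) (ψ : ℤ → ℤ → Prop) : Prop :=
  ∀ P, Describes P φ → ∃ ms Q, ms.length = k ∧ Plays (Rhombus n) P ms Q ∧ Describes Q ψ

theorem SweepFrom.append {B P Q R : Finset (ℤ × ℤ)} {s e f : ℤ × ℤ} {ds es : List (ℤ × ℤ)}
    (h : SweepFrom B P s ds e Q) (h' : SweepFrom B Q e es f R) :
    SweepFrom B P s (ds ++ es) f R := by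
  induction h with
  | nil => exact h'
  | cons hj _ ih => exact .cons hj (ih h')

theorem Plays.append {B P Q R : Finset (ℤ × ℤ)} {ms ns : List ((ℤ × ℤ) × List (ℤ × ℤ))}
    (h : Plays B P ms Q) (h' : Plays B Q ns R) : Plays B P (ms ++ ns) R := by
  induction h with
  | nil => exact h'
  | cons hm _ ih => exact .cons hm (ih h')

theorem Sweeps.trans {n : ℕ} {φ ψ χ : ℤ → ℤ → Prop} {x y x' y' z w : ℤ} {k l : ℕ}
    (h : Sweeps n φ x y k x' y' ψ) (h' : Sweeps n ψ x' y' l z w χ) :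
    Sweeps n φ x y (k + l) z w χ := by
  intro P hP
  obtain ⟨ds, Q, hds, hs, hQ⟩ := h P hP
  obtain ⟨es, R, hes, hs', hR⟩ := h' Q hQ
  exact ⟨ds ++ es, R, by simp [hds, hes], hs.append hs', hR⟩

theorem Sweeps.refl (n : ℕ) (φ : ℤ → ℤ → Prop) (x y : ℤ) : Sweeps n φ x y 0 x y φ :=
  fun P hP => ⟨[], P, rfl, .nil P _, hP⟩

theorem Sweeps.congr {n : ℕ} {φ ψ χ : ℤ → ℤ → Prop} {x y x' y' z w : ℤ} {k : ℕ}
    (h : Sweeps n φ x y k x' y' ψ) (hx : x' = z) (hy : y' = w) (hψ : ∀ u v, ψ u v ↔ χ u v) :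
    Sweeps n φ x y k z w χ := by
  subst hx hy
  obtain rfl : ψ = χ := funext fun u => funext fun v => propext (hψ u v)
  exact h

theorem Reduces.refl (n : ℕ) (φ : ℤ → ℤ → Prop) : Reduces n φ 0 φ :=
  fun P hP => ⟨[], P, rfl, .nil P, hP⟩

theorem Reduces.trans {n : ℕ} {φ ψ χ : ℤ → ℤ → Prop} {k l : ℕ}
    (h : Reduces n φ k ψ) (h' : Reduces n ψ l χ) : Reduces n φ (k + l) χ := by
  intro P hP
  obtain ⟨ms, Q, hms, hp, hQ⟩ := h P hP
  obtain ⟨ns, R, hns, hp', hR⟩ := h' Q hQ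
  exact ⟨ms ++ ns, R, by simp [hms, hns], hp.append hp', hR⟩

theorem Sweeps.reduces {n : ℕ} {φ ψ : ℤ → ℤ → Prop} {x y x' y' : ℤ} {k : ℕ}
    (h : Sweeps n φ x y k x' y' ψ) (hk : k ≠ 0) : Reduces n φ 1 ψ := by
  intro P hP
  obtain ⟨ds, Q, hds, hs, hQ⟩ := h P hP
  refine ⟨[((x, y), ds)], Q, rfl, .cons ⟨?_, _, hs⟩ (.nil Q), hQ⟩
  rintro rfl
  exact hk hds.symm

theorem mem_Rhombus {n : ℕ} {x y : ℤ} :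
    (x, y) ∈ Rhombus n ↔ (0 ≤ x ∧ x ≤ n - 1) ∧ 0 ≤ y ∧ y ≤ n - 1 := by
  simp [Rhombus]

theorem Sweeps.jump {n : ℕ} {φ ψ : ℤ → ℤ → Prop} {x y : ℤ} (dx dy : ℤ)
    (hd : (dx, dy) ∈ Dirs) (h₀ : φ x y) (h₁ : φ (x + dx) (y + dy))
    (h₂ : ¬ φ (x + dx + dx) (y + dy + dy))
    (hb : (0 ≤ x + dx + dx ∧ x + dx + dx ≤ n - 1) ∧ 0 ≤ y + dy + dy ∧ y + dy + dy ≤ n - 1)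
    (hψ : ∀ u v, ψ u v ↔ (φ u v ∧ ¬ (u = x ∧ v = y) ∧ ¬ (u = x + dx ∧ v = y + dy)) ∨
      (u = x + dx + dx ∧ v = y + dy + dy)) :
    Sweeps n φ x y 1 (x + dx + dx) (y + dy + dy) ψ := by
  intro P hP
  refine ⟨[(dx, dy)], jumpResult P (x, y) (dx, dy), rfl, .cons ⟨hd, ?_, ?_, ?_, ?_⟩ (.nil _ _), ?_⟩
  · exact (hP _ _).2 h₀
  · exact (hP _ _).2 h₁
  · exact mem_Rhombus.2 hb
  · exact fun h => h₂ ((hP _ _).1 h)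
  · intro u v
    simp [jumpResult, hψ, hP u v, or_comm]

theorem Sweeps.left {n : ℕ} {φ : ℤ → ℤ → Prop} {x y : ℤ} (k : ℕ) (h₀ : φ x y)
    (h₁ : x ≤ n - 1) (hk : 0 ≤ x - 2 * k) (hy : 0 ≤ y ∧ y ≤ n - 1)
    (hm : ∀ t : ℤ, 0 ≤ t → t < k → φ (x - 2 * t - 1) y)
    (he : ∀ t : ℤ, 0 ≤ t → t < k → ¬ φ (x - 2 * t - 2) y) :
    Sweeps n φ x y k (x - 2 * k) y
      fun u v => (φ u v ∧ ¬ (v = y ∧ x - 2 * k ≤ u ∧ u ≤ x)) ∨ (u = x - 2 * k ∧ v = y) := by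
  induction k with
  | zero =>
    refine (Sweeps.refl n φ x y).congr (by simp) rfl fun u v => ?_
    by_cases h : u = x ∧ v = y
    · obtain ⟨rfl, rfl⟩ := h
      simp [h₀]
    · by_cases hφ : φ u v
      · simp only [hφ, true_and, true_iff]; omega
      · simp only [hφ, false_and, false_or, false_iff]; omega
  | succ k ih =>
    have hm' := hm k (by omega) (by omega)
    have he' := he k (by omega) (by omega)
    push_cast at *
    refine ((ih (by omega) (fun t h h' => hm t h (by omega))
      (fun t h h' => he t h (by omega))).trans
      (Sweeps.jump (-1) 0 (by decide) (Or.inr ⟨rfl, rfl⟩) (Or.inl ⟨?_, by omega⟩) ?_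
        (by omega) (fun u v => Iff.rfl))).congr (by ring) (by ring) fun u v => ?_
    · convert hm' using 1 <;> ring
    · rintro (⟨h, -⟩ | h)
      · exact he' (by convert h using 1 <;> ring)
      · omega
    · by_cases h : φ u v
      · simp only [h, true_and]; omega
      · simp only [h, false_and, false_or]; omega

theorem Sweeps.right {n : ℕ} {φ : ℤ → ℤ → Prop} {x y : ℤ} (k : ℕ) (h₀ : φ x y)
    (h₁ : 0 ≤ x) (hk : x + 2 * k ≤ n - 1) (hy : 0 ≤ y ∧ y ≤ n - 1)
    (hm : ∀ t : ℤ, 0 ≤ t → t < k → φ (x + 2 * t + 1) y)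
    (he : ∀ t : ℤ, 0 ≤ t → t < k → ¬ φ (x + 2 * t + 2) y) :
    Sweeps n φ x y k (x + 2 * k) y
      fun u v => (φ u v ∧ ¬ (v = y ∧ x ≤ u ∧ u ≤ x + 2 * k)) ∨ (u = x + 2 * k ∧ v = y) := by
  induction k with
  | zero =>
    refine (Sweeps.refl n φ x y).congr (by simp) rfl fun u v => ?_
    by_cases h : u = x ∧ v = y
    · obtain ⟨rfl, rfl⟩ := h
      simp [h₀]
    · by_cases hφ : φ u v
      · simp only [hφ, true_and, true_iff]; omega
      · simp only [hφ, false_and, false_or, false_iff]; omega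
  | succ k ih =>
    have hm' := hm k (by omega) (by omega)
    have he' := he k (by omega) (by omega)
    push_cast at *
    refine ((ih (by omega) (fun t h h' => hm t h (by omega))
      (fun t h h' => he t h (by omega))).trans
      (Sweeps.jump 1 0 (by decide) (Or.inr ⟨rfl, rfl⟩) (Or.inl ⟨?_, by omega⟩) ?_
        (by omega) (fun u v => Iff.rfl))).congr (by ring) (by ring) fun u v => ?_
    · convert hm' using 1; ring
    · rintro (⟨h, -⟩ | h)
      · exact he' (by convert h using 1 <;> ring)
      · omega
    · by_cases h : φ u v
      · simp only [h, true_and]; omega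
      · simp only [h, false_and, false_or]; omega

theorem Sweeps.down {n : ℕ} {φ : ℤ → ℤ → Prop} {x y : ℤ} (k : ℕ) (h₀ : φ x y)
    (h₁ : y ≤ n - 1) (hk : 0 ≤ y - 2 * k) (hx : 0 ≤ x ∧ x ≤ n - 1)
    (hm : ∀ t : ℤ, 0 ≤ t → t < k → φ x (y - 2 * t - 1))
    (he : ∀ t : ℤ, 0 ≤ t → t < k → ¬ φ x (y - 2 * t - 2)) :
    Sweeps n φ x y k x (y - 2 * k)
      fun u v => (φ u v ∧ ¬ (u = x ∧ y - 2 * k ≤ v ∧ v ≤ y)) ∨ (u = x ∧ v = y - 2 * k) := by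
  induction k with
  | zero =>
    refine (Sweeps.refl n φ x y).congr rfl (by simp) fun u v => ?_
    by_cases h : u = x ∧ v = y
    · obtain ⟨rfl, rfl⟩ := h
      simp [h₀]
    · by_cases hφ : φ u v
      · simp only [hφ, true_and, true_iff]; omega
      · simp only [hφ, false_and, false_or, false_iff]; omega
  | succ k ih =>
    have hm' := hm k (by omega) (by omega)
    have he' := he k (by omega) (by omega)
    push_cast at *
    refine ((ih (by omega) (fun t h h' => hm t h (by omega))
      (fun t h h' => he t h (by omega))).trans
      (Sweeps.jump 0 (-1) (by decide) (Or.inr ⟨rfl, rfl⟩) (Or.inl ⟨?_, by omega⟩) ?_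
        (by omega) (fun u v => Iff.rfl))).congr (by ring) (by ring) fun u v => ?_
    · convert hm' using 1 <;> ring
    · rintro (⟨h, -⟩ | h)
      · exact he' (by convert h using 1 <;> ring)
      · omega
    · by_cases h : φ u v
      · simp only [h, true_and]; omega
      · simp only [h, false_and, false_or]; omega

/-- A position with a wedge of pegs. The even rows `v ≤ a` other than the row `c` hold pegs at the
even places from the diagonal on, and (for `v ≠ 0`) at the right end `u = n - 1`; the line
`v = u + 1` holds pegs at the even `u ≤ b` other than `e`; and there is one more peg `(p, q)`. -/
def Wedge (n : ℕ) (a c b e p q u v : ℤ) : Prop :=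
  (v % 2 = 0 ∧ 0 ≤ v ∧ v ≤ a ∧ v ≠ c ∧ v ≤ u ∧ 2 ≤ u ∧ u ≤ n - 1 ∧
    (u % 2 = 0 ∨ (u = n - 1 ∧ 2 ≤ v))) ∨
  (v = u + 1 ∧ u % 2 = 0 ∧ 0 ≤ u ∧ u ≤ b ∧ u ≠ e) ∨ (u = p ∧ v = q)

/-- The peg at the right end of the row `2 * k` can clear the part of this row on the right of
the diagonal. -/
theorem Wedge.sweep_row {n : ℕ} {a c b e p q k : ℤ} (hn : n % 2 = 0) (hk : 1 ≤ k)
    (hkn : 2 * k ≤ n - 2) (ha : 2 * k ≤ a) (hc : 2 * k ≠ c)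
    (hpq : ¬ (q = 2 * k ∧ 2 * k - 1 ≤ p)) :
    Sweeps n (Wedge n a c b e p q) (n - 1) (2 * k) ((n / 2 - k).toNat) (2 * k - 1) (2 * k)
     (fun u v => (Wedge n a c b e p q u v ∧ ¬ (v = 2 * k ∧ 2 * k - 1 ≤ u)) ∨
       (u = 2 * k - 1 ∧ v = 2 * k)) := by
  refine (Sweeps.left _ (Or.inl ?_) ?_ ?_ ?_ (fun t h h' => Or.inl ?_) ?_).congr ?_ ?_
    fun u v => ⟨?_, ?_⟩ <;> try omega
  · simp only [Wedge]
    omega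
  · simp only [Wedge]
    rintro (⟨h | h | h, h'⟩ | h) <;> omega
  · simp only [Wedge]
    rintro (⟨h | h | h, h'⟩ | h) <;> omega

set_option maxHeartbeats 2000000 in
theorem Wedge.reduces_loop {n : ℕ} {k : ℤ} (hn : n % 2 = 0) (hk : 3 ≤ k) (hkn : 2 * k ≤ n - 6) :
    Reduces n (Wedge n (2 * k + 2) (-1) (2 * k) (-1) (2 * k + 1) (2 * k + 2)) 6
      (Wedge n (2 * k - 4) (-1) (2 * k - 6) (-1) (2 * k - 5) (2 * k - 4)) := by
  have h₁ : Reduces n (Wedge n (2 * k + 2) (-1) (2 * k) (-1) (2 * k + 1) (2 * k + 2)) 1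
      (Wedge n (2 * k + 2) (-1) (2 * k - 2) (-1) (2 * k + 2) (2 * k + 3)) := by
    refine (Sweeps.jump (x := 2 * k) (y := 2 * k + 1) 1 1 (by decide) ?_ ?_ ?_ ?_
      fun u v => ⟨?_, ?_⟩).reduces one_ne_zero
    · exact .inr (.inl (by omega))
    · exact .inr (.inr (by omega))
    · simp only [Wedge]; omega
    · omega
    · rintro (h | h | h) <;> simp only [Wedge] <;> omega
    · rintro (⟨h | h | h, h'⟩ | h) <;> simp only [Wedge] <;> omega
  have h₂ : Reduces n (Wedge n (2 * k + 2) (-1) (2 * k - 2) (-1) (2 * k + 2) (2 * k + 3)) 1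
      (Wedge n (2 * k) (-1) (2 * k + 2) (2 * k) (2 * k + 1) (2 * k + 2)) := by
    refine ((Wedge.sweep_row (k := k + 1) hn ?_ ?_ ?_ ?_ ?_).congr rfl rfl
      fun u v => ⟨?_, ?_⟩).reduces ?_ <;> try omega
    · rintro (⟨h | h | h, h'⟩ | h) <;> simp only [Wedge] <;> omega
    · rintro (h | h | h) <;> simp only [Wedge] <;> omega
  have h₃ : Reduces n (Wedge n (2 * k) (-1) (2 * k + 2) (2 * k) (2 * k + 1) (2 * k + 2)) 1
      (Wedge n (2 * k) (-1) (2 * k) (-1) (2 * k) (2 * k + 1)) := by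
    refine (Sweeps.jump (x := 2 * k + 2) (y := 2 * k + 3) (-1) (-1) (by decide) ?_ ?_ ?_ ?_
      fun u v => ⟨?_, ?_⟩).reduces one_ne_zero
    · exact .inr (.inl (by omega))
    · exact .inr (.inr (by omega))
    · simp only [Wedge]; omega
    · omega
    · rintro (h | h | h) <;> simp only [Wedge] <;> omega
    · rintro (⟨h | h | h, h'⟩ | h) <;> simp only [Wedge] <;> omega
  have h₄ : Reduces n (Wedge n (2 * k) (-1) (2 * k) (-1) (2 * k) (2 * k + 1)) 1
      (Wedge n (2 * k) (2 * k - 2) (2 * k) (2 * k - 2) (2 * k - 1) (2 * k)) := by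
    refine ((Wedge.sweep_row (k := k - 1) hn ?_ ?_ ?_ ?_ ?_).trans (Sweeps.jump 1 1 (by decide)
      ?_ ?_ ?_ ?_ fun u v => ⟨?_, ?_⟩)).reduces (by omega)
    · omega
    · omega
    · omega
    · omega
    · omega
    · exact .inr (by omega)
    · exact .inl ⟨.inr (.inl (by omega)), by omega⟩
    · simp only [Wedge]; omega
    · omega
    · rintro (h | h | h) <;> simp only [Wedge] <;> omega
    · rintro (⟨⟨h | h | h, h'⟩ | h, h₂⟩ | h) <;> simp only [Wedge] <;> omega
  have h₅ : Reduces n (Wedge n (2 * k) (2 * k - 2) (2 * k) (2 * k - 2) (2 * k - 1) (2 * k)) 1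
      (Wedge n (2 * k) (2 * k - 2) (2 * k - 2) (-1) (2 * k - 2) (2 * k - 1)) := by
    refine (Sweeps.jump (x := 2 * k) (y := 2 * k + 1) (-1) (-1) (by decide) ?_ ?_ ?_ ?_
      fun u v => ⟨?_, ?_⟩).reduces one_ne_zero
    · exact .inr (.inl (by omega))
    · exact .inr (.inr (by omega))
    · simp only [Wedge]; omega
    · omega
    · rintro (h | h | h) <;> simp only [Wedge] <;> omega
    · rintro (⟨h | h | h, h'⟩ | h) <;> simp only [Wedge] <;> omega
  have h₆ : Reduces n (Wedge n (2 * k) (2 * k - 2) (2 * k - 2) (-1) (2 * k - 2) (2 * k - 1)) 1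
      (Wedge n (2 * k - 4) (-1) (2 * k - 6) (-1) (2 * k - 5) (2 * k - 4)) := by
    refine (((Wedge.sweep_row (k := k) hn ?_ ?_ ?_ ?_ ?_).trans (Sweeps.jump
      (ψ := Wedge n (2 * k - 4) (-1) (2 * k - 4) (-1) (2 * k - 3) (2 * k - 2)) (-1) (-1) (by decide)
      ?_ ?_ ?_ ?_ fun u v => ⟨?_, ?_⟩)).trans (Sweeps.jump (-1) (-1) (by decide)
      ?_ ?_ ?_ ?_ fun u v => ⟨?_, ?_⟩)).reduces (by omega)
    · omega
    · omega
    · omega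
    · omega
    · omega
    · exact .inr (by omega)
    · exact .inl ⟨.inr (.inl (by omega)), by omega⟩
    · simp only [Wedge]; omega
    · omega
    · rintro (h | h | h) <;> simp only [Wedge] <;> omega
    · rintro (⟨⟨h | h | h, h'⟩ | h, h₂⟩ | h) <;> simp only [Wedge] <;> omega
    · exact .inr (.inr (by omega))
    · exact .inr (.inl (by omega))
    · simp only [Wedge]; omega
    · omega
    · rintro (h | h | h) <;> simp only [Wedge] <;> omega
    · rintro (⟨h | h | h, h'⟩ | h) <;> simp only [Wedge] <;> omega
  exact ((((h₁.trans h₂).trans h₃).trans h₄).trans h₅).trans h₆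

theorem Wedge.reduces_loops {n : ℕ} (hn : n % 2 = 0) (j : ℕ) (hj : 6 * j + 6 ≤ n) :
    Reduces n (Wedge n (6 * j + 2) (-1) (6 * j) (-1) (6 * j + 1) (6 * j + 2)) (6 * j)
      (Wedge n 2 (-1) 0 (-1) 1 2) := by
  induction j with
  | zero => exact Reduces.refl _ _
  | succ j ih =>
    have h := Wedge.reduces_loop (n := n) (k := 3 * j + 3) hn (by omega) (by omega)
    have h' := h.trans (ψ := Wedge n (2 * (3 * j + 3) - 4) (-1) (2 * (3 * j + 3) - 6) (-1)
      (2 * (3 * j + 3) - 5) (2 * (3 * j + 3) - 4)) (k := 6) (l := 6 * j)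
      (χ := Wedge n 2 (-1) 0 (-1) 1 2) (by convert ih (by omega) using 2 <;> ring)
    convert h' using 1
    · congr 1 <;> push_cast <;> ring
    · ring

theorem Wedge.reduces_end {n : ℕ} (hn : n % 2 = 0) (hn₆ : 6 ≤ n) :
    Reduces n (Wedge n 2 (-1) 0 (-1) 1 2) 5 (fun u v => u = n - 1 ∧ v = 0) := by
  have h₁ : Reduces n (Wedge n 2 (-1) 0 (-1) 1 2) 1 (Wedge n 2 (-1) (-1) (-1) 2 3) := by
    refine (Sweeps.jump (x := 0) (y := 1) 1 1 (by decide) ?_ ?_ ?_ ?_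
      fun u v => ⟨?_, ?_⟩).reduces one_ne_zero
    · exact .inr (.inl (by omega))
    · exact .inr (.inr (by omega))
    · simp only [Wedge]; omega
    · omega
    · rintro (h | h | h) <;> simp only [Wedge] <;> omega
    · rintro (⟨h | h | h, h'⟩ | h) <;> simp only [Wedge] <;> omega
  have h₂ : Reduces n (Wedge n 2 (-1) (-1) (-1) 2 3) 1 (fun u v =>
      (v = 0 ∧ u % 2 = 0 ∧ 2 ≤ u ∧ u ≤ n - 2) ∨ (v = 2 ∧ u % 2 = 0 ∧ 4 ≤ u ∧ u ≤ n - 2) ∨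
      (u = n - 1 ∧ v = 2) ∨ (u = 2 ∧ v = 1)) := by
    refine (Sweeps.jump (x := 2) (y := 3) 0 (-1) (by decide) ?_ ?_ ?_ ?_
      fun u v => ⟨?_, ?_⟩).reduces one_ne_zero
    · exact .inr (.inr (by omega))
    · exact .inl (by omega)
    · simp only [Wedge]; omega
    · omega
    · rintro (h | h | h | h) <;> simp only [Wedge] <;> omega
    · rintro (⟨h | h | h, h'⟩ | h) <;> omega
  have h₃ : Reduces n (fun u v =>
      (v = 0 ∧ u % 2 = 0 ∧ 2 ≤ u ∧ u ≤ n - 2) ∨ (v = 2 ∧ u % 2 = 0 ∧ 4 ≤ u ∧ u ≤ n - 2) ∨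
      (u = n - 1 ∧ v = 2) ∨ (u = 2 ∧ v = 1)) 1 (fun u v =>
      (v = 0 ∧ u % 2 = 0 ∧ 2 ≤ u ∧ u ≤ n - 2) ∨ (u = 3 ∧ v = 2) ∨ (u = 2 ∧ v = 1)) := by
    refine ((Sweeps.left (x := n - 1) (y := 2) (n / 2 - 2) ?_ ?_ ?_ ?_ ?_ ?_).congr rfl rfl
      fun u v => ⟨?_, ?_⟩).reduces (by omega)
    · omega
    · omega
    · omega
    · omega
    · omega
    · omega
    · rintro (⟨h | h | h | h, h'⟩ | h) <;> omega
    · rintro (h | h | h) <;> omega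
  have h₄ : Reduces n (fun u v =>
      (v = 0 ∧ u % 2 = 0 ∧ 2 ≤ u ∧ u ≤ n - 2) ∨ (u = 3 ∧ v = 2) ∨ (u = 2 ∧ v = 1)) 1 (fun u v =>
      (v = 0 ∧ u % 2 = 0 ∧ 2 ≤ u ∧ u ≤ n - 2) ∨ (u = 1 ∧ v = 0)) := by
    refine (Sweeps.jump (x := 3) (y := 2) (-1) (-1) (by decide) ?_ ?_ ?_ ?_
      fun u v => ?_).reduces one_ne_zero <;> omega
  have h₅ : Reduces n (fun u v =>
      (v = 0 ∧ u % 2 = 0 ∧ 2 ≤ u ∧ u ≤ n - 2) ∨ (u = 1 ∧ v = 0)) 1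
      (fun u v => u = n - 1 ∧ v = 0) := by
    refine ((Sweeps.right (x := 1) (y := 0) (n / 2 - 1) ?_ ?_ ?_ ?_ ?_ ?_).congr rfl rfl
      fun u v => ?_).reduces ?_ <;> omega
  exact (((h₁.trans h₂).trans h₃).trans h₄).trans h₅

/-- The start of the reduction after `a` of its column sweeps. The pegs at the even-even holes
other than the origin remain except above the diagonal in the swept columns `u < 2 * a`. The right
border holds pegs at the even `v ≥ 2`. The pegs on the upper border at the even `u ≤ n - 4` have
moved down to the line `v = u + 1` in the swept columns. -/
def Comb (n : ℕ) (a u v : ℤ) : Prop :=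
  (u % 2 = 0 ∧ v % 2 = 0 ∧ 0 ≤ u ∧ 0 ≤ v ∧ u ≤ n - 2 ∧ v ≤ n - 2 ∧ 2 ≤ u + v ∧
    (v ≤ u ∨ 2 * a ≤ u)) ∨
  (u = n - 1 ∧ v % 2 = 0 ∧ 2 ≤ v ∧ v ≤ n - 2) ∨
  (v = u + 1 ∧ u % 2 = 0 ∧ 0 ≤ u ∧ u < 2 * a) ∨
  (v = n - 1 ∧ u % 2 = 0 ∧ 0 ≤ u ∧ 2 * a ≤ u ∧ u ≤ n - 4)

theorem Comb.reduces_column {n : ℕ} {a : ℤ} (hn : n % 2 = 0) (ha : 0 ≤ a) (han : 2 * a ≤ n - 4) :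
    Reduces n (Comb n a) 1 (Comb n (a + 1)) := by
  refine ((Sweeps.down (x := 2 * a) (y := n - 1) (n / 2 - 1 - a).toNat ?_ ?_ ?_ ?_
    (fun t h h' => ?_) ?_).congr rfl rfl fun u v => ⟨?_, ?_⟩).reduces ?_
  · exact .inr (.inr (.inr (by omega)))
  · omega
  · omega
  · omega
  · exact .inl (by omega)
  · simp only [Comb]; omega
  · rintro (⟨h | h | h | h, h'⟩ | h) <;> simp only [Comb] <;> omega
  · rintro (h | h | h | h) <;> simp only [Comb] <;> omega
  · omega

theorem Comb.reduces_columns {n : ℕ} (hn : n % 2 = 0) (a : ℕ) (ha : 2 * a + 2 ≤ n) :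
    Reduces n (Comb n 0) a (Comb n a) := by
  induction a with
  | zero => exact Reduces.refl _ _
  | succ a ih =>
    push_cast
    exact (ih (by omega)).trans (Comb.reduces_column hn (by omega) (by omega))

theorem Comb.reduces_wedge {n : ℕ} {a : ℤ} (hn : n % 2 = 0) (hn₆ : 6 ≤ n) (ha : 2 * a = n - 2) :
    Reduces n (Comb n a) 1 (Wedge n (n - 4) (-1) (n - 6) (-1) (n - 5) (n - 4)) := by
  have h : Comb n a = Wedge n (2 * a) (-1) (n - 6) (-1) (n - 4) (n - 3) := by
    funext u v
    refine propext ⟨?_, ?_⟩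
    · rintro (h | h | h | h) <;> simp only [Wedge] <;> omega
    · rintro (h | h | h) <;> simp only [Comb] <;> omega
  rw [h]
  refine ((Wedge.sweep_row (k := a) hn ?_ ?_ ?_ ?_ ?_).trans (Sweeps.jump (-1) (-1) (by decide)
    ?_ ?_ ?_ ?_ fun u v => ⟨?_, ?_⟩)).reduces (by omega)
  · omega
  · omega
  · omega
  · omega
  · omega
  · exact .inr (by omega)
  · exact .inl ⟨.inr (.inr (by omega)), by omega⟩
  · simp only [Wedge]; omega
  · omega
  · rintro (h | h | h) <;> simp only [Wedge] <;> omega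
  · rintro (⟨⟨h | h | h, h'⟩ | h, h₂⟩ | h) <;> simp only [Wedge] <;> omega

theorem Comb.reduces_corner (i : ℕ) (hi : 2 ≤ i) :
    Reduces (6 * i) (Comb (6 * i) 0) (9 * i - 1) (fun u v => u = (6 * i : ℕ) - 1 ∧ v = 0) := by
  obtain ⟨j, rfl⟩ : ∃ j, i = j + 1 := ⟨i - 1, by omega⟩
  have h₁ := Comb.reduces_columns (n := 6 * (j + 1)) (by omega) (3 * j + 2) (by omega)
  have h₂ := Comb.reduces_wedge (n := 6 * (j + 1)) (a := (3 * j + 2 : ℕ)) (by omega) (by omega)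
    (by omega)
  have h₃ := Wedge.reduces_loops (n := 6 * (j + 1)) (by omega) j (by omega)
  have h₄ := Wedge.reduces_end (n := 6 * (j + 1)) (by omega) (by omega)
  have h := h₁.trans h₂
  rw [show ((6 * (j + 1) : ℕ) : ℤ) - 4 = 6 * j + 2 by push_cast; ring,
    show ((6 * (j + 1) : ℕ) : ℤ) - 6 = 6 * j by push_cast; ring,
    show ((6 * (j + 1) : ℕ) : ℤ) - 5 = 6 * j + 1 by push_cast; ring] at h
  convert (h.trans h₃).trans h₄ using 1
  omega

/-- The holes off the even-even sublattice that hold a peg at the start of the long sweep. -/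
def OffLattice (n : ℕ) (u v : ℤ) : Prop :=
  0 ≤ u ∧ u ≤ n - 1 ∧ 0 ≤ v ∧ v ≤ n - 1 ∧ ¬ (u % 2 = 0 ∧ v % 2 = 0) ∧
    ¬ (u = n - 1 ∧ v % 2 = 0 ∧ 2 ≤ v) ∧ ¬ (v = n - 1 ∧ u % 2 = 0 ∧ u ≤ n - 4)

/-- The position in which the long sweep has arrived at `(0, 2 * j)`, having cleared all lower
rows up to the borders. -/
def TourRow (n : ℕ) (j u v : ℤ) : Prop :=
  (u = 0 ∧ v = 2 * j) ∨ (OffLattice n u v ∧ (2 * j ≤ v ∨ u = n - 1 ∨ v = n - 1))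

/-- The position in which the long sweep has arrived at `(2 * t, 2 * j)` during its zigzag back
to the left between the rows `2 * j` and `2 * j + 2`. -/
def TourZigzag (n : ℕ) (j t u v : ℤ) : Prop :=
  (u = 2 * t ∧ v = 2 * j) ∨ (OffLattice n u v ∧
    (2 * j + 2 ≤ v ∨ (v = 2 * j + 1 ∧ u ≤ 2 * t) ∨ u = n - 1 ∨ v = n - 1))

theorem TourRow.sweep_right {m : ℕ} {j : ℤ} (hm : 1 ≤ m) (hj : 0 ≤ j) (hjm : j ≤ m - 1) :
    Sweeps (2 * m) (TourRow (2 * m) j) 0 (2 * j) (m - 1) (2 * (m - 1 : ℕ)) (2 * j)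
      (TourZigzag (2 * m) j (m - 1 : ℕ)) := by
  refine (Sweeps.right (m - 1) ?_ ?_ ?_ ?_ (fun t h h' => ?_) ?_).congr ?_ rfl
    fun u v => ⟨?_, ?_⟩
  · exact .inl ⟨rfl, rfl⟩
  · omega
  · omega
  · omega
  · exact .inr ⟨by simp only [OffLattice]; omega, by omega⟩
  · simp only [TourRow, OffLattice]; omega
  · omega
  · simp only [TourRow, TourZigzag, OffLattice]
    rintro (⟨h | h, h'⟩ | h) <;> omega
  · simp only [TourRow, TourZigzag, OffLattice]
    rintro (h | h) <;> omega

theorem TourZigzag.sweep_zigzag {m : ℕ} {j t : ℤ} (hj : 0 ≤ j) (hjm : j ≤ m - 2) (ht : 0 ≤ t)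
    (htm : t ≤ m - 2) :
    Sweeps (2 * m) (TourZigzag (2 * m) j (t + 1)) (2 * (t + 1)) (2 * j) 2 (2 * t) (2 * j)
      (TourZigzag (2 * m) j t) := by
  refine (Sweeps.trans (Sweeps.jump (ψ := fun u v => (u = 2 * t + 2 ∧ v = 2 * j + 2) ∨
    (OffLattice (2 * m) u v ∧ (2 * j + 2 ≤ v ∨ (v = 2 * j + 1 ∧ u ≤ 2 * t + 1) ∨
      u = (2 * m : ℕ) - 1 ∨ v = (2 * m : ℕ) - 1))) 0 1 (by decide) ?_ ?_ ?_ ?_ fun u v => ⟨?_, ?_⟩)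
    (Sweeps.jump (ψ := TourZigzag (2 * m) j t) (-1) (-1) (by decide) ?_ ?_ ?_ ?_
      fun u v => ⟨?_, ?_⟩)).congr ?_ ?_ fun u v => Iff.rfl
  · exact .inl ⟨rfl, rfl⟩
  · exact .inr ⟨by simp only [OffLattice]; omega, by omega⟩
  · simp only [TourZigzag, OffLattice]; omega
  · omega
  · simp only [TourZigzag, OffLattice]
    rintro (h | h) <;> omega
  · simp only [TourZigzag, OffLattice]
    rintro (⟨h | h, h'⟩ | h) <;> omega
  · exact .inl (by omega)
  · exact .inr ⟨by simp only [OffLattice]; omega, by omega⟩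
  · simp only [OffLattice]; omega
  · omega
  · simp only [TourZigzag, OffLattice]
    rintro (h | h) <;> omega
  · simp only [TourZigzag, OffLattice]
    rintro (⟨h | h, h'⟩ | h) <;> omega
  · omega
  · omega

theorem TourZigzag.sweep_back {m : ℕ} {j : ℤ} (hj : 0 ≤ j) (hjm : j ≤ m - 2) (t : ℕ)
    (htm : t + 1 ≤ m) :
    Sweeps (2 * m) (TourZigzag (2 * m) j t) (2 * t) (2 * j) (2 * t) 0 (2 * j)
      (TourZigzag (2 * m) j 0) := by
  induction t with
  | zero => exact Sweeps.refl _ _ _ _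
  | succ t ih =>
    have h := (TourZigzag.sweep_zigzag (t := t) hj hjm (by omega) (by omega)).trans
      (ih (by omega))
    rw [show 2 * (t + 1) = 2 + 2 * t by ring]
    exact_mod_cast h

theorem TourZigzag.sweep_up {m : ℕ} {j : ℤ} (hj : 0 ≤ j) (hjm : j ≤ m - 2) :
    Sweeps (2 * m) (TourZigzag (2 * m) j 0) 0 (2 * j) 1 0 (2 * (j + 1))
      (TourRow (2 * m) (j + 1)) := by
  refine (Sweeps.jump (ψ := TourRow (2 * m) (j + 1)) 0 1 (by decide) ?_ ?_ ?_ ?_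
    fun u v => ⟨?_, ?_⟩).congr ?_ ?_ fun u v => Iff.rfl
  · exact .inl ⟨rfl, rfl⟩
  · exact .inr ⟨by simp only [OffLattice]; omega, by omega⟩
  · simp only [TourZigzag, OffLattice]; omega
  · omega
  · simp only [TourRow, TourZigzag, OffLattice]
    rintro (h | h) <;> omega
  · simp only [TourRow, TourZigzag, OffLattice]
    rintro (⟨h | h, h'⟩ | h) <;> omega
  · omega
  · omega

theorem TourRow.sweep_rows {m : ℕ} (j : ℕ) (hj : j + 1 ≤ m) :
    Sweeps (2 * m) (TourRow (2 * m) 0) 0 0 (j * (m - 1 + 2 * (m - 1) + 1)) 0 (2 * j)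
      (TourRow (2 * m) j) := by
  induction j with
  | zero => simpa using Sweeps.refl _ _ _ _
  | succ j ih =>
    rw [add_one_mul]
    push_cast
    exact (ih (by omega)).trans (((TourRow.sweep_right (by omega) (by omega) (by omega)).trans
      (TourZigzag.sweep_back (by omega) (by omega) (m - 1) (by omega))).trans
      (TourZigzag.sweep_up (by omega) (by omega)))

theorem TourRow.sweep_tour {m : ℕ} (hm : 1 ≤ m) :
    Sweeps (2 * m) (TourRow (2 * m) 0) 0 0 ((3 * m - 1) * (m - 1)) (2 * (m - 1 : ℕ))
      (2 * (m - 1 : ℕ)) (TourZigzag (2 * m) (m - 1 : ℕ) (m - 1 : ℕ)) := by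
  have h := (TourRow.sweep_rows (m - 1) (by omega)).trans
    (TourRow.sweep_right hm (by omega) (by omega))
  obtain ⟨k, rfl⟩ : ∃ k, m = k + 1 := ⟨m - 1, by omega⟩
  convert h using 1
  rw [show 3 * (k + 1) - 1 = 3 * k + 2 by omega, Nat.add_sub_cancel]
  ring

theorem tourRow_zero_iff {n : ℕ} (hn : n % 2 = 0) (hn₂ : 2 ≤ n) {u v : ℤ} :
    TourRow n 0 u v ↔ (u, v) ∈ Rhombus n ∧ ¬ Comb n 0 u v := by
  simp only [mem_Rhombus, Comb, TourRow, OffLattice]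
  rcases Int.emod_two_eq_zero_or_one u with hu | hu <;>
    rcases Int.emod_two_eq_zero_or_one v with hv | hv <;>
    simp only [hu, hv, one_ne_zero, true_and, false_and, and_false, false_or, or_false,
      not_false_eq_true, not_true_eq_false, and_true, and_self] <;> omega

/-- For every integer `i ≥ 2`, there is a position `P` on `Rhombus (6*i)`
from which a sweep of length `(9*i-1)*(3*i-1)` is legal, such that the complement
position can be reduced by exactly `9*i-1` moves to a single peg at a corner. -/
theorem rhombus6i_sweep_complement_reducible (i : ℕ) (hi : 2 ≤ i) :
    ∃ P ⊆ Rhombus (6 * i),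
      (∃ (s : ℤ × ℤ) (ds : List (ℤ × ℤ)) (e : ℤ × ℤ) (Q : Finset (ℤ × ℤ)),
        ds ≠ [] ∧ SweepFrom (Rhombus (6 * i)) P s ds e Q ∧
        ds.length = (9 * i - 1) * (3 * i - 1)) ∧
      (∃ (ms : List ((ℤ × ℤ) × List (ℤ × ℤ))) (c : ℤ × ℤ),
        c ∈ ({(0, 0), (6 * (i : ℤ) - 1, 0), (0, 6 * (i : ℤ) - 1),
              (6 * (i : ℤ) - 1, 6 * (i : ℤ) - 1)} : Finset (ℤ × ℤ)) ∧
        Plays (Rhombus (6 * i)) (Rhombus (6 * i) \ P) ms {c} ∧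
        ms.length = 9 * i - 1) := by
  classical
  have hComb : ∀ u v : ℤ, Comb (6 * i) 0 u v → (u, v) ∈ Rhombus (6 * i) := by
    intro u v
    simp only [mem_Rhombus]
    rintro (h | h | h | h) <;> omega
  have hP : Describes {p ∈ Rhombus (6 * i) | ¬ Comb (6 * i) 0 p.1 p.2} (TourRow (6 * i) 0) :=
    fun u v => by rw [Finset.mem_filter, tourRow_zero_iff (by omega) (by omega)]
  have hC : Describes (Rhombus (6 * i) \ {p ∈ Rhombus (6 * i) | ¬ Comb (6 * i) 0 p.1 p.2})
      (Comb (6 * i) 0) := by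
    intro u v
    simp only [Finset.mem_sdiff, Finset.mem_filter, not_and, not_not]
    exact ⟨fun h => h.2 h.1, fun h => ⟨hComb u v h, fun _ => h⟩⟩
  refine ⟨{p ∈ Rhombus (6 * i) | ¬ Comb (6 * i) 0 p.1 p.2}, Finset.filter_subset _ _, ?_, ?_⟩
  · have h := TourRow.sweep_tour (m := 3 * i) (by omega)
    rw [show 2 * (3 * i) = 6 * i by ring, show 3 * (3 * i) = 9 * i by ring] at h
    obtain ⟨ds, Q, hds, hs, -⟩ := h _ hP
    refine ⟨_, ds, _, Q, ?_, hs, hds⟩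
    rintro rfl
    have : 0 < (9 * i - 1) * (3 * i - 1) := Nat.mul_pos (by omega) (by omega)
    exact this.ne hds
  · obtain ⟨ms, Q, hms, hp, hQ⟩ := Comb.reduces_corner i hi _ hC
    refine ⟨ms, (6 * i - 1, 0), by simp, ?_, hms⟩
    obtain rfl : Q = {(6 * (i : ℤ) - 1, 0)} := by
      ext ⟨u, v⟩
      rw [hQ u v]
      simp
    exact hp
end

section
/- Let B be any board and let P be a position on B from which a super-sweep is legal. Then there is no position Q on B and no legal jump in Q whose resulting position is P; that is, a super-sweep position can never occur during the solution of a peg solitaire problem except as the initial position. -/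
theorem not_even_of_mem_Dirs {d : ℤ × ℤ} (hd : d ∈ Dirs) : ¬ Even d := by
  rintro ⟨⟨a, b⟩, rfl⟩
  simp only [Dirs, Finset.mem_insert, Finset.mem_singleton, Prod.mk_add_mk, Prod.mk.injEq] at hd
  omega

/-- A hole touched by a sweep and empty at its start is in the parity class of the
starting hole: holes of the other classes can only be jumped over, so they hold pegs. -/
theorem SweepFrom.even_sub_of_notMem {B P Q : Finset (ℤ × ℤ)} {s e : ℤ × ℤ}
    {ds : List (ℤ × ℤ)} (h : SweepFrom B P s ds e Q) {b : ℤ × ℤ}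
    (hb : b ∈ sweepHoles s ds) (hbP : b ∉ P) : Even (b - s) := by
  induction h with
  | nil P s =>
    obtain rfl : b = s := by simpa [sweepHoles] using hb
    simp
  | @cons P s d e ds Q hj _ ih =>
    simp only [sweepHoles, List.mem_cons] at hb
    rcases hb with rfl | rfl | hb
    · simp
    · exact absurd hj.2.2.1 hbP
    · by_cases hbd : b = s + d + d
      · exact ⟨d, by rw [hbd]; abel⟩
      · obtain ⟨r, hr⟩ := ih hb (by simp [jumpResult, hbP, hbd])
        exact ⟨r + d, by rw [sub_eq_iff_eq_add.mp hr]; abel⟩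

/-- A jump empties its starting hole. -/
theorem JumpOK.start_notMem_jumpResult {B Q : Finset (ℤ × ℤ)} {p d : ℤ × ℤ}
    (h : JumpOK B Q p d) : p ∉ jumpResult Q p d := by
  have hne : p ≠ p + d + d := fun heq => h.2.2.2.2 (heq ▸ h.2.1)
  simp only [jumpResult, Finset.mem_union, Finset.mem_sdiff, Finset.mem_insert,
    Finset.mem_singleton]
  tauto

/-- A jump empties the hole jumped over. -/
theorem JumpOK.middle_notMem_jumpResult {B Q : Finset (ℤ × ℤ)} {p d : ℤ × ℤ}
    (h : JumpOK B Q p d) : p + d ∉ jumpResult Q p d := by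
  have hne : p + d ≠ p + d + d := fun heq => h.2.2.2.2 (heq ▸ h.2.2.1)
  simp only [jumpResult, Finset.mem_union, Finset.mem_sdiff, Finset.mem_insert,
    Finset.mem_singleton]
  tauto

/-- If a super-sweep is legal from position `P` on a board `B`, then no
position `Q` on `B` admits a legal jump whose resulting position is `P`. -/
theorem supersweep_position_unreachable (B P : Finset (ℤ × ℤ)) (hP : P ⊆ B)
    (hss : ∃ (s : ℤ × ℤ) (ds : List (ℤ × ℤ)) (e : ℤ × ℤ) (Q : Finset (ℤ × ℤ)),
      ds ≠ [] ∧ SweepFrom B P s ds e Q ∧ ∀ b ∈ B, b ∈ sweepHoles s ds) :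
    ¬ ∃ (Q : Finset (ℤ × ℤ)) (p d : ℤ × ℤ),
        Q ⊆ B ∧ JumpOK B Q p d ∧ jumpResult Q p d = P := by
  rintro ⟨Q, p, d, hQB, hj, rfl⟩
  obtain ⟨s, ds, e, R, -, hsweep, hcover⟩ := hss
  have hp := hsweep.even_sub_of_notMem (hcover p (hQB hj.2.1)) hj.start_notMem_jumpResult
  have hm := hsweep.even_sub_of_notMem (hcover (p + d) (hQB hj.2.2.1))
    hj.middle_notMem_jumpResult
  apply not_even_of_mem_Dirs hj.1
  simpa using hm.sub hp
end

section
/- For every hole v on the board Rhombus(6), the v-complement problem is solvable: there is a finite sequence of jumps leading from the position Rhombus(6) \ {v} to the position {v} consisting of a single peg at v. -/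
/-- Execute a list of jumps, each given by its starting hole and direction;
`none` if one of them is illegal. -/
def playJumps (B : Finset (ℤ × ℤ)) :
    Finset (ℤ × ℤ) → List ((ℤ × ℤ) × (ℤ × ℤ)) → Option (Finset (ℤ × ℤ))
  | P, [] => some P
  | P, (p, d) :: js =>
    if d ∈ Dirs ∧ p ∈ P ∧ p + d ∈ P ∧ p + d + d ∈ B ∧ p + d + d ∉ P then
      playJumps B (jumpResult P p d) js
    else none

theorem reflTransGen_of_playJumps {B P Q : Finset (ℤ × ℤ)} {js : List ((ℤ × ℤ) × (ℤ × ℤ))}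
    (h : playJumps B P js = some Q) : Relation.ReflTransGen (JumpStep B) P Q := by
  induction js generalizing P with
  | nil =>
    cases h
    exact .refl
  | cons j js ih =>
    obtain ⟨p, d⟩ := j
    rw [playJumps] at h
    split at h
    · next hj => exact .head ⟨p, d, hj, rfl⟩ (ih h)
    · cases h

/-- A symmetry of the board, acting on directions by `τ`, transports jumps. -/
theorem JumpStep.map {B P Q : Finset (ℤ × ℤ)} (σ : ℤ × ℤ ≃ ℤ × ℤ) (τ : ℤ × ℤ → ℤ × ℤ)
    (hστ : ∀ p d, σ (p + d) = σ p + τ d) (hτ : ∀ d ∈ Dirs, τ d ∈ Dirs)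
    (hB : ∀ p ∈ B, σ p ∈ B) (h : JumpStep B P Q) :
    JumpStep B (P.map σ.toEmbedding) (Q.map σ.toEmbedding) := by
  obtain ⟨p, d, ⟨hd, hp, hpd, hB', hP⟩, rfl⟩ := h
  refine ⟨σ p, τ d, ⟨hτ d hd, ?_⟩, ?_⟩
  · simp only [← hστ]
    exact ⟨by simpa using hp, by simpa using hpd, hB _ hB', by simpa using hP⟩
  · simp only [jumpResult, ← hστ]
    simp [Finset.map_eq_image, Finset.image_sdiff _ _ σ.injective]

/-- A symmetry of the board carries a solution of the `v`-complement problem to a solution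
of the complement problem at the image of `v`. -/
theorem complement_solvable_map {B : Finset (ℤ × ℤ)} {v : ℤ × ℤ}
    (σ : ℤ × ℤ ≃ ℤ × ℤ) (τ : ℤ × ℤ → ℤ × ℤ)
    (hστ : ∀ p d, σ (p + d) = σ p + τ d) (hτ : ∀ d ∈ Dirs, τ d ∈ Dirs)
    (hB : B.map σ.toEmbedding = B)
    (h : Relation.ReflTransGen (JumpStep B) (B.erase v) {v}) :
    Relation.ReflTransGen (JumpStep B) (B.erase (σ v)) {σ v} := by
  have hB' : ∀ p ∈ B, σ p ∈ B := fun p hp => by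
    rw [← hB]
    exact Finset.mem_map_of_mem _ hp
  have hmap := h.lift (Finset.map σ.toEmbedding) fun _ _ => JumpStep.map σ τ hστ hτ hB'
  rwa [Function.onFun, Finset.map_erase, hB, Finset.map_singleton] at hmap

theorem complement_solvable_swap {n : ℕ} {v : ℤ × ℤ}
    (h : Relation.ReflTransGen (JumpStep (Rhombus n)) ((Rhombus n).erase v) {v}) :
    Relation.ReflTransGen (JumpStep (Rhombus n)) ((Rhombus n).erase v.swap) {v.swap} := by
  refine complement_solvable_map (Equiv.prodComm ℤ ℤ) Prod.swap (fun _ _ => rfl) (by decide) ?_ h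
  ext ⟨x, y⟩
  simp [Rhombus, Finset.mem_map_equiv, and_comm]

theorem complement_solvable_reflect {n : ℕ} {v : ℤ × ℤ}
    (h : Relation.ReflTransGen (JumpStep (Rhombus n)) ((Rhombus n).erase v) {v}) :
    Relation.ReflTransGen (JumpStep (Rhombus n))
      ((Rhombus n).erase (((n : ℤ) - 1, (n : ℤ) - 1) - v)) {((n : ℤ) - 1, (n : ℤ) - 1) - v} := by
  refine complement_solvable_map (Equiv.subLeft ((n : ℤ) - 1, (n : ℤ) - 1)) Neg.neg
    (fun p d => ?_) (by decide) ?_ h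
  · simp only [Equiv.subLeft_apply]
    abel
  · ext ⟨x, y⟩
    simp [Rhombus, Finset.mem_map_equiv]
    omega

/-- Solutions of the complement problems on `Rhombus 6`, one for each hole of a fundamental
domain of its symmetry group. Each jump is given by its starting hole and direction. -/
def rhombus6Solutions : List ((ℤ × ℤ) × List ((ℤ × ℤ) × (ℤ × ℤ))) :=
  [((0, 0),
     [((0, 2), (0, -1)), ((2, 3), (-1, -1)), ((3, 2), (-1, 0)), ((5, 4), (-1, -1)), ((5, 2), (0, 1)),
      ((5, 5), (0, -1)), ((0, 4), (0, -1)), ((4, 5), (0, -1)), ((2, 5), (0, -1)), ((0, 5), (1, 0)),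
      ((3, 5), (-1, 0)), ((0, 2), (1, 1)), ((1, 5), (0, -1)), ((4, 2), (-1, 0)), ((5, 0), (0, 1)),
      ((5, 2), (0, 1)), ((2, 4), (1, 0)), ((5, 4), (-1, 0)), ((4, 0), (0, 1)), ((1, 0), (1, 1)),
      ((3, 0), (-1, 0)), ((0, 0), (0, 1)), ((0, 2), (1, 1)), ((2, 4), (1, 0)), ((4, 3), (-1, -1)),
      ((1, 0), (1, 1)), ((2, 3), (1, 0)), ((4, 3), (-1, -1)), ((2, 1), (1, 0)), ((4, 1), (0, 1)),
      ((4, 4), (0, -1)), ((1, 2), (1, 0)), ((4, 2), (-1, 0)), ((2, 2), (-1, -1))]),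
   ((0, 1),
     [((2, 3), (-1, -1)), ((0, 3), (1, 0)), ((3, 3), (-1, 0)), ((3, 5), (0, -1)), ((5, 4), (-1, 0)),
      ((5, 2), (0, 1)), ((5, 5), (0, -1)), ((1, 5), (1, 0)), ((0, 5), (0, -1)), ((4, 5), (-1, 0)),
      ((5, 0), (0, 1)), ((5, 3), (0, -1)), ((2, 5), (0, -1)), ((3, 0), (1, 0)), ((5, 0), (0, 1)),
      ((1, 0), (0, 1)), ((5, 2), (-1, -1)), ((4, 2), (0, 1)), ((3, 0), (-1, 0)), ((3, 3), (-1, -1)),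
      ((3, 1), (0, 1)), ((4, 4), (-1, -1)), ((0, 2), (1, 1)), ((0, 0), (0, 1)), ((1, 0), (1, 1)),
      ((1, 1), (0, 1)), ((0, 2), (0, 1)), ((3, 2), (-1, 0)), ((2, 3), (-1, 0)), ((0, 3), (1, 1)),
      ((3, 4), (-1, 0)), ((0, 4), (1, 0)), ((2, 5), (0, -1)), ((2, 3), (-1, -1))]),
   ((0, 2),
     [((0, 0), (0, 1)), ((2, 3), (-1, -1)), ((3, 2), (-1, 0)), ((3, 0), (0, 1)), ((5, 3), (-1, -1)),
      ((4, 5), (-1, -1)), ((2, 5), (1, 0)), ((5, 5), (-1, 0)), ((5, 0), (-1, 0)), ((5, 1), (0, 1)),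
      ((5, 4), (0, -1)), ((4, 4), (0, -1)), ((0, 5), (1, 0)), ((2, 0), (-1, 0)), ((4, 2), (-1, 0)),
      ((3, 5), (-1, 0)), ((3, 0), (0, 1)), ((3, 3), (0, -1)), ((5, 2), (-1, -1)), ((3, 0), (0, 1)),
      ((1, 1), (1, 0)), ((3, 1), (0, 1)), ((3, 3), (-1, -1)), ((0, 3), (0, 1)), ((0, 0), (1, 1)),
      ((0, 1), (0, 1)), ((2, 4), (-1, -1)), ((0, 5), (1, 0)), ((2, 2), (0, 1)), ((0, 2), (1, 0)),
      ((2, 5), (0, -1)), ((2, 2), (0, 1)), ((2, 4), (-1, 0)), ((0, 4), (0, -1))]),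
   ((0, 3),
     [((2, 3), (-1, 0)), ((0, 1), (1, 1)), ((1, 0), (0, 1)), ((3, 0), (-1, 0)), ((5, 0), (-1, 0)),
      ((3, 1), (-1, 0)), ((5, 1), (-1, 0)), ((4, 3), (-1, -1)), ((5, 2), (-1, 0)), ((3, 5), (-1, -1)),
      ((5, 5), (-1, 0)), ((5, 3), (0, 1)), ((2, 5), (1, 0)), ((5, 5), (-1, 0)), ((4, 4), (-1, 0)),
      ((0, 5), (1, 0)), ((3, 2), (0, 1)), ((3, 0), (0, 1)), ((0, 3), (0, -1)), ((3, 5), (0, -1)),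
      ((0, 0), (0, 1)), ((3, 2), (0, 1)), ((1, 0), (1, 1)), ((2, 5), (-1, -1)), ((0, 3), (0, -1)),
      ((3, 4), (-1, 0)), ((0, 1), (1, 0)), ((0, 4), (1, 0)), ((1, 3), (0, -1)), ((3, 2), (-1, 0)),
      ((2, 4), (0, -1)), ((2, 1), (0, 1)), ((1, 1), (0, 1)), ((2, 3), (-1, 0))]),
   ((0, 4),
     [((0, 2), (0, 1)), ((2, 2), (-1, 0)), ((4, 2), (-1, 0)), ((2, 0), (1, 1)), ((4, 0), (-1, 0)),
      ((5, 2), (-1, -1)), ((0, 5), (0, -1)), ((5, 3), (-1, -1)), ((5, 0), (0, 1)), ((0, 2), (0, 1)),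
      ((3, 0), (0, 1)), ((0, 0), (0, 1)), ((5, 5), (0, -1)), ((5, 2), (0, 1)), ((2, 5), (-1, 0)),
      ((0, 5), (0, -1)), ((3, 2), (-1, 0)), ((5, 4), (-1, -1)), ((4, 4), (-1, -1)), ((4, 5), (-1, 0)),
      ((2, 0), (-1, 0)), ((0, 3), (0, -1)), ((0, 0), (0, 1)), ((1, 1), (1, 1)), ((0, 2), (1, 0)),
      ((3, 4), (-1, -1)), ((2, 5), (0, -1)), ((3, 3), (0, -1)), ((3, 1), (-1, 0)), ((2, 3), (-1, -1)),
      ((2, 2), (-1, -1)), ((0, 0), (0, 1)), ((0, 2), (1, 1)), ((2, 4), (-1, 0))]),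
   ((0, 5),
     [((0, 3), (0, 1)), ((2, 3), (-1, 0)), ((4, 5), (-1, -1)), ((3, 2), (0, 1)), ((5, 2), (-1, 0)),
      ((5, 0), (0, 1)), ((5, 3), (0, -1)), ((2, 0), (1, 1)), ((5, 1), (-1, 0)), ((4, 0), (-1, 0)),
      ((5, 5), (0, -1)), ((3, 1), (0, 1)), ((5, 3), (-1, -1)), ((1, 0), (1, 0)), ((3, 0), (0, 1)),
      ((3, 3), (-1, 0)), ((0, 2), (0, 1)), ((0, 0), (0, 1)), ((3, 5), (0, -1)), ((2, 1), (0, 1)),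
      ((3, 2), (0, 1)), ((0, 5), (0, -1)), ((4, 4), (0, -1)), ((0, 2), (1, 0)), ((1, 1), (1, 1)),
      ((1, 5), (1, 0)), ((2, 3), (1, 0)), ((0, 3), (1, 0)), ((3, 5), (-1, -1)), ((4, 2), (0, 1)),
      ((4, 4), (-1, 0)), ((2, 4), (-1, 0)), ((2, 3), (-1, 0)), ((0, 3), (0, 1))]),
   ((1, 1),
     [((3, 3), (-1, -1)), ((3, 5), (0, -1)), ((5, 4), (-1, 0)), ((5, 2), (0, 1)), ((5, 0), (0, 1)),
      ((5, 5), (0, -1)), ((5, 2), (0, 1)), ((1, 5), (1, 0)), ((2, 0), (0, 1)), ((3, 5), (1, 0)),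
      ((5, 5), (0, -1)), ((0, 1), (1, 0)), ((4, 0), (-1, 0)), ((0, 3), (0, -1)), ((0, 5), (0, -1)),
      ((3, 3), (-1, -1)), ((5, 3), (-1, 0)), ((2, 0), (0, 1)), ((0, 0), (0, 1)), ((2, 3), (0, -1)),
      ((4, 2), (-1, 0)), ((0, 3), (0, -1)), ((1, 0), (1, 1)), ((4, 1), (-1, 0)), ((3, 2), (-1, -1)),
      ((0, 1), (1, 1)), ((3, 4), (-1, -1)), ((1, 2), (1, 0)), ((3, 2), (0, 1)), ((1, 3), (0, 1)),
      ((3, 4), (-1, 0)), ((1, 0), (0, 1)), ((1, 5), (0, -1)), ((1, 3), (0, -1))]),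
   ((1, 2),
     [((3, 2), (-1, 0)), ((3, 0), (0, 1)), ((5, 1), (-1, 0)), ((5, 3), (0, -1)), ((5, 0), (0, 1)),
      ((1, 0), (1, 0)), ((4, 0), (-1, 0)), ((2, 0), (0, 1)), ((0, 1), (1, 0)), ((0, 3), (0, -1)),
      ((0, 0), (0, 1)), ((5, 5), (0, -1)), ((5, 2), (0, 1)), ((3, 5), (1, 0)), ((0, 5), (0, -1)),
      ((5, 5), (0, -1)), ((2, 5), (-1, 0)), ((0, 2), (0, 1)), ((0, 5), (0, -1)), ((2, 4), (-1, 0)),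
      ((0, 4), (0, -1)), ((0, 2), (1, 1)), ((3, 1), (-1, 0)), ((1, 1), (0, 1)), ((3, 4), (-1, 0)),
      ((1, 4), (0, -1)), ((1, 2), (1, 1)), ((3, 4), (1, 0)), ((2, 2), (1, 1)), ((4, 2), (-1, 0)),
      ((5, 4), (0, -1)), ((4, 4), (0, -1)), ((5, 2), (-1, 0)), ((3, 2), (-1, 0))]),
   ((1, 3),
     [((3, 3), (-1, 0)), ((3, 1), (0, 1)), ((5, 2), (-1, 0)), ((0, 3), (1, 0)), ((5, 0), (0, 1)),
      ((3, 5), (-1, -1)), ((5, 3), (0, -1)), ((5, 1), (-1, 0)), ((5, 5), (-1, 0)), ((2, 0), (1, 1)),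
      ((4, 0), (-1, 0)), ((0, 2), (1, 1)), ((1, 5), (0, -1)), ((3, 5), (-1, 0)), ((0, 0), (0, 1)),
      ((0, 5), (0, -1)), ((3, 4), (-1, 0)), ((0, 2), (0, 1)), ((5, 4), (-1, 0)), ((0, 4), (1, 0)),
      ((1, 2), (0, 1)), ((1, 5), (0, -1)), ((3, 4), (-1, 0)), ((1, 4), (0, -1)), ((1, 1), (1, 0)),
      ((1, 0), (1, 0)), ((4, 2), (-1, -1)), ((4, 3), (-1, -1)), ((1, 2), (1, 0)), ((3, 3), (0, -1)),
      ((3, 0), (-1, 0)), ((1, 0), (1, 1)), ((3, 1), (0, 1)), ((3, 3), (-1, 0))]),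
   ((1, 4),
     [((1, 2), (0, 1)), ((1, 0), (0, 1)), ((3, 1), (-1, 0)), ((5, 3), (-1, -1)), ((5, 5), (0, -1)),
      ((5, 2), (0, 1)), ((3, 0), (1, 1)), ((5, 0), (-1, 0)), ((5, 1), (0, 1)), ((0, 1), (1, 0)),
      ((0, 3), (0, -1)), ((0, 0), (0, 1)), ((0, 5), (0, -1)), ((5, 3), (0, 1)), ((3, 5), (-1, -1)),
      ((5, 5), (-1, 0)), ((3, 0), (-1, 0)), ((2, 2), (0, 1)), ((0, 2), (1, 0)), ((3, 1), (-1, 0)),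
      ((1, 0), (0, 1)), ((2, 5), (1, 0)), ((0, 3), (1, 0)), ((3, 2), (1, 1)), ((1, 5), (0, -1)),
      ((2, 2), (-1, 0)), ((4, 5), (0, -1)), ((5, 4), (-1, -1)), ((2, 3), (1, 0)), ((3, 2), (1, 1)),
      ((2, 4), (1, 0)), ((0, 2), (1, 1)), ((5, 4), (-1, 0)), ((3, 4), (-1, 0))]),
   ((2, 2),
     [((0, 2), (1, 0)), ((1, 0), (0, 1)), ((3, 0), (-1, 0)), ((5, 0), (-1, 0)), ((3, 3), (-1, -1)),
      ((3, 5), (0, -1)), ((5, 5), (-1, 0)), ((2, 5), (1, 0)), ((0, 5), (1, 0)), ((0, 4), (0, -1)),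
      ((0, 0), (1, 0)), ((2, 0), (0, 1)), ((5, 3), (0, 1)), ((5, 5), (-1, 0)), ((5, 1), (0, 1)),
      ((4, 1), (-1, 0)), ((5, 3), (-1, -1)), ((4, 4), (0, -1)), ((4, 2), (-1, -1)), ((3, 0), (-1, 0)),
      ((0, 1), (0, 1)), ((3, 5), (-1, 0)), ((0, 3), (1, 1)), ((1, 2), (0, 1)), ((1, 0), (0, 1)),
      ((3, 3), (0, -1)), ((3, 1), (-1, 0)), ((1, 1), (0, 1)), ((2, 5), (-1, 0)), ((2, 4), (-1, 0)),
      ((2, 2), (0, 1)), ((0, 5), (0, -1)), ((0, 3), (1, 0)), ((2, 4), (0, -1))]),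
   ((2, 3),
     [((0, 1), (1, 1)), ((1, 0), (0, 1)), ((3, 3), (-1, -1)), ((3, 5), (0, -1)), ((5, 4), (-1, 0)),
      ((5, 2), (0, 1)), ((5, 5), (0, -1)), ((5, 0), (0, 1)), ((0, 3), (0, -1)), ((0, 0), (0, 1)),
      ((0, 5), (0, -1)), ((2, 0), (0, 1)), ((0, 3), (0, -1)), ((5, 3), (0, -1)), ((0, 1), (1, 0)),
      ((4, 2), (0, 1)), ((4, 5), (0, -1)), ((4, 0), (-1, 0)), ((2, 0), (1, 1)), ((5, 1), (-1, 0)),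
      ((1, 3), (0, -1)), ((3, 4), (-1, -1)), ((1, 1), (0, 1)), ((4, 3), (-1, 0)), ((1, 3), (1, 0)),
      ((2, 1), (0, 1)), ((2, 3), (1, 0)), ((4, 3), (-1, -1)), ((2, 1), (1, 0)), ((1, 5), (1, 0)),
      ((1, 4), (1, 0)), ((3, 5), (0, -1)), ((4, 1), (0, 1)), ((4, 3), (-1, 0))])]

theorem playJumps_rhombus6Solutions :
    ∀ s ∈ rhombus6Solutions, playJumps (Rhombus 6) ((Rhombus 6).erase s.1) s.2 = some {s.1} := by
  decide +kernel

theorem rhombus6_complement_solvable_of_fundamental {x y : ℤ} (hx : 0 ≤ x) (hxy : x ≤ y)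
    (hy : x + y ≤ 5) :
    Relation.ReflTransGen (JumpStep (Rhombus 6)) ((Rhombus 6).erase (x, y)) {(x, y)} := by
  have hmem : (x, y) ∈ rhombus6Solutions.map Prod.fst := by
    have hx' : x ≤ 2 := by omega
    have hy' : y ≤ 5 := by omega
    interval_cases x <;> interval_cases y <;> first | omega | decide
  obtain ⟨s, hs, hsv⟩ := List.mem_map.mp hmem
  rw [← hsv]
  exact reflTransGen_of_playJumps (playJumps_rhombus6Solutions s hs)

theorem rhombus6_complement_solvable_of_le {x y : ℤ} (hx : 0 ≤ x) (hxy : x ≤ y) (hy : y ≤ 5) :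
    Relation.ReflTransGen (JumpStep (Rhombus 6)) ((Rhombus 6).erase (x, y)) {(x, y)} := by
  by_cases h : x + y ≤ 5
  · exact rhombus6_complement_solvable_of_fundamental hx hxy h
  · have key := complement_solvable_reflect (complement_solvable_swap
      (rhombus6_complement_solvable_of_fundamental (x := 5 - y) (y := 5 - x)
        (by omega) (by omega) (by omega)))
    norm_num at key
    exact key

/-- Every complement problem on `Rhombus 6` is solvable: from the position
with a single vacancy at `v` one can reach, by a finite sequence of jumps, the position
with a single peg at `v`. -/
theorem rhombus6_complement_solvable :
    ∀ v ∈ Rhombus 6,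
      Relation.ReflTransGen (JumpStep (Rhombus 6)) ((Rhombus 6).erase v) {v} := by
  rintro ⟨x, y⟩ hv
  simp only [Rhombus, Finset.mem_product, Finset.mem_Icc] at hv
  obtain ⟨⟨hx, hx'⟩, hy, hy'⟩ := hv
  rcases le_total x y with h | h
  · exact rhombus6_complement_solvable_of_le hx h (by omega)
  · exact complement_solvable_swap (rhombus6_complement_solvable_of_le hy h (by omega))
end

section
/- For every n with 2 ≤ n ≤ 5 and every hole v on the board Rhombus(n), the v-complement problem is unsolvable; thus Rhombus(6) is the smallest rhombus board on which a complement problem is solvable. -/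
/-- `w` is an additive weight on `B` preserved by every jump inside `B`. -/
def IsJumpInvariant {A : Type*} [AddCommMonoid A] (B : Finset (ℤ × ℤ)) (w : ℤ × ℤ → A) : Prop :=
  ∀ p ∈ B, ∀ d ∈ Dirs, p + d ∈ B → p + d + d ∈ B → w p + w (p + d) = w (p + d + d)

lemma ne_zero_of_mem_Dirs {d : ℤ × ℤ} (hd : d ∈ Dirs) : d ≠ 0 := by
  rintro rfl
  exact absurd hd (by decide)

lemma JumpStep.subset {B P Q : Finset (ℤ × ℤ)} (h : JumpStep B P Q) (hP : P ⊆ B) : Q ⊆ B := by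
  obtain ⟨p, d, ⟨-, -, -, hB, -⟩, rfl⟩ := h
  exact Finset.union_subset (Finset.sdiff_subset.trans hP) (Finset.singleton_subset_iff.2 hB)

lemma JumpStep.sum_eq {A : Type*} [AddCommMonoid A] {B P Q : Finset (ℤ × ℤ)} {w : ℤ × ℤ → A}
    (hw : IsJumpInvariant B w) (h : JumpStep B P Q) (hP : P ⊆ B) :
    ∑ x ∈ Q, w x = ∑ x ∈ P, w x := by
  obtain ⟨p, d, ⟨hd, hp, hpd, hB, hn⟩, rfl⟩ := h
  have hne : p ≠ p + d := fun h => ne_zero_of_mem_Dirs hd (by simpa using h)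
  have hsub : ({p, p + d} : Finset (ℤ × ℤ)) ⊆ P := by
    simp [Finset.insert_subset_iff, hp, hpd]
  have hdisj : Disjoint (P \ {p, p + d}) {p + d + d} :=
    Finset.disjoint_singleton_right.2 fun h => hn (Finset.sdiff_subset h)
  rw [jumpResult, Finset.sum_union hdisj, Finset.sum_singleton,
    ← hw p (hP hp) d hd (hP hpd) hB, ← Finset.sum_pair hne, Finset.sum_sdiff hsub]

lemma sum_eq_of_reflTransGen_jumpStep {A : Type*} [AddCommMonoid A] {B P Q : Finset (ℤ × ℤ)}
    {w : ℤ × ℤ → A} (hw : IsJumpInvariant B w) (hP : P ⊆ B)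
    (h : Relation.ReflTransGen (JumpStep B) P Q) :
    ∑ x ∈ Q, w x = ∑ x ∈ P, w x := by
  suffices Q ⊆ B ∧ ∑ x ∈ Q, w x = ∑ x ∈ P, w x from this.2
  induction h with
  | refl => exact ⟨hP, rfl⟩
  | tail _ hstep ih => exact ⟨hstep.subset ih.1, (hstep.sum_eq hw ih.1).trans ih.2⟩

/-- If the `v`-complement problem is solvable, the whole board weighs twice as much as `v`. -/
lemma sum_eq_two_nsmul_of_complement_solvable {A : Type*} [AddCommMonoid A]
    {B : Finset (ℤ × ℤ)} {w : ℤ × ℤ → A} (hw : IsJumpInvariant B w) {v : ℤ × ℤ} (hv : v ∈ B)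
    (h : Relation.ReflTransGen (JumpStep B) (B.erase v) {v}) :
    ∑ x ∈ B, w x = 2 • w v := by
  rw [← Finset.add_sum_erase B w hv,
    ← sum_eq_of_reflTransGen_jumpStep hw (Finset.erase_subset v B) h, Finset.sum_singleton,
    two_nsmul]

/-- The three diagonal classes `x + y mod 3`, mapped to the nonzero elements of the Klein group. -/
def classWeight (p : ℤ × ℤ) : ZMod 2 × ZMod 2 :=
  if (p.1 + p.2) % 3 = 0 then (1, 0) else if (p.1 + p.2) % 3 = 1 then (0, 1) else (1, 1)

lemma isJumpInvariant_classWeight_rhombus {n : ℕ} (hn : n ≤ 5) :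
    IsJumpInvariant (Rhombus n) classWeight := by
  unfold IsJumpInvariant
  interval_cases n <;> decide

/-- On `Rhombus 3`, corner pegs only jump between corners and are never captured. -/
def cornerWeight (p : ℤ × ℤ) : ℕ :=
  if p.1 ≠ 1 ∧ p.2 ≠ 1 then 1 else 0

lemma isJumpInvariant_cornerWeight_rhombus_three :
    IsJumpInvariant (Rhombus 3) cornerWeight := by
  unfold IsJumpInvariant
  decide

/-- For every `n` with `2 ≤ n ≤ 5` and every hole `v` of `Rhombus n`,
the `v`-complement problem is unsolvable. -/
theorem rhombus_small_complement_unsolvable (n : ℕ) (h2 : 2 ≤ n) (h5 : n ≤ 5) :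
    ∀ v ∈ Rhombus n,
      ¬ Relation.ReflTransGen (JumpStep (Rhombus n)) ((Rhombus n).erase v) {v} := by
  intro v hv h
  have hclass := sum_eq_two_nsmul_of_complement_solvable
    (isJumpInvariant_classWeight_rhombus h5) hv h
  rw [show 2 • classWeight v = 0 from (by decide : ∀ a : ZMod 2 × ZMod 2, 2 • a = 0) _] at hclass
  interval_cases n
  · exact absurd hclass (by decide)
  · have hcorner := sum_eq_two_nsmul_of_complement_solvable
      isJumpInvariant_cornerWeight_rhombus_three hv h
    rw [show ∑ x ∈ Rhombus 3, cornerWeight x = 4 by decide, cornerWeight] at hcorner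
    split_ifs at hcorner
    simp at hcorner
  · exact absurd hclass (by decide)
  · exact absurd hclass (by decide)
end

section
/- For every hole v on the board Rhombus(6), there exists a solution to the single-vacancy peg solitaire problem with vacancy v (ending with exactly one peg, not necessarily at v) that contains a move which is a sweep of length 16. -/
namespace PegSolitaire

/-- The index of a hole of `Rhombus 6` in lexicographic order. -/
def code (h : ℤ × ℤ) : ℕ := (6 * h.1 + h.2).toNat

/-- The position on `Rhombus 6` whose occupied holes are the bits of `m`. -/
noncomputable def position (m : ℕ) : Finset (ℤ × ℤ) :=
  (Rhombus 6).filter fun h => m.testBit (code h)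

/-- The hole `h` lies on `Rhombus 6`. -/
def OnBoard (h : ℤ × ℤ) : Prop := 0 ≤ h.1 ∧ h.1 ≤ 5 ∧ 0 ≤ h.2 ∧ h.2 ≤ 5

instance : DecidablePred OnBoard := fun _ => inferInstanceAs (Decidable (_ ∧ _ ∧ _ ∧ _))

/-- The jump `(p, d)` is legal in `position m`. -/
def MaskJumpOK (m : ℕ) (p d : ℤ × ℤ) : Prop :=
  d ∈ Dirs ∧ OnBoard p ∧ OnBoard (p + d) ∧ OnBoard (p + d + d) ∧
    m.testBit (code p) = true ∧ m.testBit (code (p + d)) = true ∧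
    m.testBit (code (p + d + d)) = false

instance (m : ℕ) (p d : ℤ × ℤ) : Decidable (MaskJumpOK m p d) :=
  inferInstanceAs (Decidable (_ ∧ _ ∧ _ ∧ _ ∧ _ ∧ _ ∧ _))

/-- The mask of the position after the jump `(p, d)`. -/
def maskJump (m : ℕ) (p d : ℤ × ℤ) : ℕ :=
  m ^^^ (2 ^ code p ^^^ 2 ^ code (p + d) ^^^ 2 ^ code (p + d + d))

/-- The mask after the peg at `p` jumps successively in the directions `ds`, if this is legal. -/
def maskSweep (m : ℕ) (p : ℤ × ℤ) : List (ℤ × ℤ) → Option ℕ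
  | [] => some m
  | d :: ds => if MaskJumpOK m p d then maskSweep (maskJump m p d) (p + d + d) ds else none

/-- The mask after playing the moves `ms`, if this is legal. -/
def maskPlay (m : ℕ) : List ((ℤ × ℤ) × List (ℤ × ℤ)) → Option ℕ
  | [] => some m
  | (_, []) :: _ => none
  | (p, d :: ds) :: ms => (maskSweep m p (d :: ds)).bind fun m' => maskPlay m' ms

theorem mem_rhombus_six {h : ℤ × ℤ} : h ∈ Rhombus 6 ↔ OnBoard h := by
  simp [Rhombus, OnBoard, and_assoc]

theorem mem_position {m : ℕ} {h : ℤ × ℤ} :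
    h ∈ position m ↔ OnBoard h ∧ m.testBit (code h) = true := by
  simp [position, mem_rhombus_six]

theorem code_inj {h k : ℤ × ℤ} (hh : OnBoard h) (hk : OnBoard k) : code h = code k ↔ h = k := by
  unfold OnBoard at hh hk
  rw [Prod.ext_iff, code, code]
  omega

theorem position_two_pow {h : ℤ × ℤ} (hh : OnBoard h) : position (2 ^ code h) = {h} := by
  ext k
  rw [mem_position, Finset.mem_singleton, Nat.testBit_two_pow, decide_eq_true_iff]
  constructor
  · rintro ⟨hk, h_eq⟩
    exact ((code_inj hh hk).1 h_eq).symm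
  · rintro rfl
    exact ⟨hh, rfl⟩

theorem position_full_xor {v : ℤ × ℤ} (hv : OnBoard v) :
    position ((2 ^ 36 - 1) ^^^ 2 ^ code v) = (Rhombus 6).erase v := by
  ext h
  rw [mem_position, Finset.mem_erase, mem_rhombus_six, and_comm, and_congr_left_iff]
  intro hh
  have h_lt : code h < 36 := by
    unfold OnBoard at hh
    unfold code
    omega
  rw [Nat.testBit_xor, Nat.testBit_two_pow_sub_one, Nat.testBit_two_pow]
  simp [h_lt, code_inj hv hh, eq_comm (a := h)]

theorem MaskJumpOK.jumpOK {m : ℕ} {p d : ℤ × ℤ} (h : MaskJumpOK m p d) :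
    JumpOK (Rhombus 6) (position m) p d := by
  obtain ⟨hd, h₀, h₁, h₂, b₀, b₁, b₂⟩ := h
  simp [JumpOK, mem_position, mem_rhombus_six, *]

theorem MaskJumpOK.position_maskJump {m : ℕ} {p d : ℤ × ℤ} (h : MaskJumpOK m p d) :
    position (maskJump m p d) = jumpResult (position m) p d := by
  obtain ⟨-, h₀, h₁, h₂, b₀, b₁, b₂⟩ := h
  have h_ne {j k : ℤ × ℤ} (hj : m.testBit (code j) = true) (hk : m.testBit (code k) = false) :
      k ≠ j := by
    rintro rfl
    simp_all
  ext k
  by_cases hk : OnBoard k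
  · simp only [maskJump, jumpResult, mem_position, Nat.testBit_xor, Nat.testBit_two_pow,
      code_inj h₀ hk, code_inj h₁ hk, code_inj h₂ hk, Finset.mem_union, Finset.mem_sdiff,
      Finset.mem_insert, Finset.mem_singleton]
    have h₂₀ := h_ne b₀ b₂
    have h₂₁ := h_ne b₁ b₂
    have hd : d ≠ 0 := by
      rintro rfl
      simp at h₂₁
    by_cases e₂ : k = p + d + d
    · subst e₂
      simp [hk, b₂, h₂₀.symm, h₂₁.symm]
    by_cases e₀ : k = p
    · subst e₀
      simp [b₀, hd, e₂, Ne.symm e₂]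
    by_cases e₁ : k = p + d
    · subst e₁
      simp [b₁, hd]
    simp [hk, e₀, e₁, e₂, Ne.symm e₀, Ne.symm e₁, Ne.symm e₂]
  · have : k ≠ p + d + d := fun h_eq => hk (h_eq ▸ h₂)
    simp [jumpResult, mem_position, hk, this]

theorem sweepFrom_of_maskSweep {ds : List (ℤ × ℤ)} {m' : ℕ} :
    ∀ {m : ℕ} {p : ℤ × ℤ}, maskSweep m p ds = some m' →
      SweepFrom (Rhombus 6) (position m) p ds (sweepEnd p ds) (position m') := by
  induction ds with
  | nil =>
    rintro m p ⟨⟩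
    exact .nil _ _
  | cons d ds ih =>
    intro m p h
    rw [maskSweep, Option.ite_none_right_eq_some] at h
    exact .cons h.1.jumpOK (h.1.position_maskJump ▸ ih h.2)

theorem plays_of_maskPlay {ms : List ((ℤ × ℤ) × List (ℤ × ℤ))} {m' : ℕ} :
    ∀ {m : ℕ}, maskPlay m ms = some m' → Plays (Rhombus 6) (position m) ms (position m') := by
  induction ms with
  | nil =>
    rintro m ⟨⟩
    exact .nil _
  | cons mv ms ih =>
    intro m h
    match mv with
    | (p, []) => cases h
    | (p, d :: ds) =>
      obtain ⟨k, h_sweep, h_rest⟩ := Option.bind_eq_some_iff.1 h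
      exact .cons ⟨List.cons_ne_nil _ _, _, sweepFrom_of_maskSweep h_sweep⟩ (ih h_rest)

/-- The direction `(1, 0)`. -/
abbrev e : ℤ × ℤ := (1, 0)

/-- The direction `(-1, 0)`. -/
abbrev w : ℤ × ℤ := (-1, 0)

/-- The direction `(0, 1)`. -/
abbrev n : ℤ × ℤ := (0, 1)

/-- The direction `(0, -1)`. -/
abbrev s : ℤ × ℤ := (0, -1)

/-- The direction `(1, 1)`. -/
abbrev ne : ℤ × ℤ := (1, 1)

/-- The direction `(-1, -1)`. -/
abbrev sw : ℤ × ℤ := (-1, -1)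

/-- The openings, listed by vacancy in lexicographic order. The triple `(x, y, d)` is the jump of
the peg at `(x, y)` in direction `d`. Each opening leaves a peg at `(0, 0)`, a peg at every hole of
`Rhombus 5` with an odd coordinate, and at most one further peg, outside `Rhombus 5`. -/
def openings : List (List (ℤ × ℤ × (ℤ × ℤ))) :=
  [[(2, 0, w), (3, 2, sw), (3, 0, n), (3, 3, s), (5, 3, w), (5, 1, n), (5, 4, s), (5, 2, w),
    (5, 0, w), (4, 5, s), (2, 3, s), (0, 3, e), (3, 5, sw), (0, 5, s), (2, 5, w), (0, 2, n),
    (0, 5, s)],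
   [(2, 3, sw), (3, 2, w), (3, 0, n), (3, 3, s), (5, 5, sw), (5, 0, w), (5, 2, s), (5, 4, s),
    (5, 2, w), (2, 0, e), (5, 0, w), (0, 3, e), (3, 5, sw), (0, 5, s), (2, 5, w), (0, 2, n),
    (0, 5, s)],
   [(0, 4, s), (2, 5, sw), (1, 2, n), (1, 0, n), (3, 3, sw), (5, 3, w), (5, 1, n), (5, 4, s),
    (0, 2, e), (3, 0, w), (3, 5, sw), (5, 5, w), (0, 5, e), (2, 5, e), (5, 0, w), (3, 2, w),
    (5, 2, w), (4, 5, s)],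
   [(0, 5, s), (2, 5, w), (2, 3, n), (4, 5, sw), (3, 2, n), (3, 5, s), (5, 4, w), (3, 0, n),
    (5, 3, sw), (5, 0, w), (5, 2, s), (2, 0, e), (5, 0, w), (2, 2, n), (2, 5, s), (0, 2, n),
    (0, 5, s)],
   [(0, 2, n), (2, 5, sw), (1, 2, n), (3, 5, sw), (5, 5, w), (0, 4, e), (3, 4, w), (5, 4, w),
    (3, 2, w), (3, 0, n), (5, 3, sw), (5, 0, w), (5, 2, s), (2, 0, e), (5, 0, w), (0, 5, e),
    (2, 5, e)],
   [(2, 5, w), (0, 3, ne), (1, 2, n), (1, 0, n), (3, 3, sw), (5, 3, w), (5, 1, n), (5, 4, s),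
    (0, 2, e), (3, 0, w), (3, 5, sw), (5, 5, w), (2, 5, e), (0, 5, s), (5, 0, w), (3, 2, w),
    (5, 2, w), (4, 5, s)],
   [(3, 2, sw), (3, 0, n), (3, 3, s), (5, 5, sw), (5, 0, w), (5, 2, s), (5, 4, s), (5, 2, w),
    (2, 0, e), (5, 0, w), (2, 3, s), (0, 3, e), (3, 5, sw), (0, 5, s), (2, 5, w), (0, 2, n),
    (0, 5, s)],
   [(1, 3, s), (3, 3, w), (0, 3, e), (3, 2, w), (3, 0, n), (5, 3, sw), (5, 0, w), (5, 2, s),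
    (5, 5, s), (5, 3, w), (2, 0, e), (0, 5, s), (3, 5, sw), (0, 2, ne), (1, 5, e), (3, 5, sw),
    (5, 0, w), (4, 5, s)],
   [(3, 2, w), (2, 4, s), (4, 5, sw), (5, 4, w), (3, 0, n), (5, 3, sw), (5, 0, w), (5, 2, s),
    (2, 0, e), (5, 0, w), (2, 2, n), (0, 3, e), (3, 5, sw), (0, 5, s), (2, 5, w), (0, 2, n),
    (0, 5, s)],
   [(1, 5, s), (1, 2, n), (3, 5, sw), (5, 5, w), (0, 4, e), (3, 4, w), (5, 4, w), (3, 2, w),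
    (3, 0, n), (5, 3, sw), (5, 0, w), (5, 2, s), (2, 0, e), (5, 0, w), (2, 5, e), (0, 2, n),
    (0, 5, s)],
   [(1, 2, n), (3, 3, w), (0, 3, e), (3, 2, w), (3, 0, n), (5, 3, sw), (5, 0, w), (5, 2, s),
    (5, 5, s), (5, 3, w), (2, 0, e), (0, 5, s), (3, 5, sw), (0, 2, ne), (1, 5, e), (3, 5, sw),
    (5, 0, w), (4, 5, s)],
   [(3, 5, w), (0, 3, ne), (3, 4, w), (5, 4, w), (4, 2, n), (2, 2, e), (3, 0, n), (5, 3, sw),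
    (5, 0, w), (5, 2, s), (2, 0, e), (5, 0, w), (4, 5, s), (0, 5, s), (2, 5, w), (0, 2, n),
    (0, 5, s)],
   [(4, 0, w), (5, 2, sw), (4, 3, s), (2, 3, e), (0, 3, e), (2, 0, ne), (5, 3, sw), (5, 5, s),
    (5, 3, w), (2, 2, e), (0, 5, s), (3, 5, sw), (0, 2, ne), (1, 5, e), (3, 5, sw), (5, 0, n),
    (5, 2, w), (4, 5, s)],
   [(4, 3, sw), (4, 5, s), (2, 4, e), (5, 4, w), (3, 0, n), (5, 3, sw), (5, 0, w), (5, 2, s),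
    (2, 0, e), (5, 0, w), (2, 2, n), (0, 3, e), (3, 5, sw), (0, 5, s), (2, 5, w), (0, 2, n),
    (0, 5, s)],
   [(4, 4, sw), (5, 3, w), (5, 5, s), (2, 1, ne), (3, 0, n), (5, 3, sw), (5, 0, w), (5, 2, s),
    (2, 0, e), (5, 0, w), (2, 3, s), (0, 3, e), (3, 5, sw), (0, 5, s), (2, 5, w), (0, 2, n),
    (0, 5, s)],
   [(0, 3, e), (1, 5, s), (1, 2, n), (1, 0, n), (3, 3, sw), (5, 3, w), (5, 1, n), (5, 4, s),
    (0, 2, e), (3, 0, w), (3, 5, sw), (5, 5, w), (2, 5, e), (0, 5, s), (5, 0, w), (3, 2, w),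
    (5, 2, w), (4, 5, s)],
   [(2, 2, n), (4, 5, sw), (3, 2, n), (5, 5, sw), (3, 0, n), (5, 3, sw), (5, 1, n), (5, 3, n),
    (5, 0, w), (2, 0, n), (2, 3, s), (0, 3, e), (3, 5, sw), (0, 5, s), (2, 5, w), (0, 2, n),
    (0, 5, s)],
   [(0, 3, ne), (1, 2, n), (3, 2, w), (3, 0, n), (3, 3, s), (5, 5, sw), (5, 0, w), (5, 2, s),
    (5, 4, s), (5, 2, w), (2, 0, e), (5, 0, w), (3, 5, sw), (0, 5, s), (2, 5, w), (0, 2, n),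
    (0, 5, s)],
   [(5, 0, w), (5, 2, s), (5, 4, s), (3, 2, ne), (4, 5, s), (2, 4, e), (5, 4, w), (5, 2, w),
    (2, 0, e), (5, 0, w), (2, 2, n), (0, 3, e), (3, 5, sw), (0, 5, s), (2, 5, w), (0, 2, n),
    (0, 5, s)],
   [(3, 3, s), (5, 5, sw), (2, 4, e), (5, 4, w), (3, 0, n), (5, 3, sw), (5, 0, w), (5, 2, s),
    (2, 0, e), (5, 0, w), (2, 2, n), (0, 3, e), (3, 5, sw), (0, 5, s), (2, 5, w), (0, 2, n),
    (0, 5, s)],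
   [(3, 0, n), (5, 3, sw), (2, 2, e), (5, 4, sw), (2, 3, e), (0, 3, e), (5, 0, w), (5, 2, s),
    (2, 0, e), (0, 5, s), (3, 5, sw), (0, 2, ne), (1, 5, e), (3, 5, sw), (5, 5, sw), (5, 0, w),
    (4, 2, n), (4, 5, s)],
   [(5, 5, sw), (4, 2, n), (2, 2, e), (3, 0, n), (5, 3, sw), (5, 1, n), (5, 3, n), (5, 0, w),
    (4, 5, s), (2, 0, n), (2, 3, s), (0, 3, e), (3, 5, sw), (0, 5, s), (2, 5, w), (0, 2, n),
    (0, 5, s)],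
   [(3, 2, n), (5, 5, sw), (2, 4, e), (5, 4, w), (3, 0, n), (5, 3, sw), (5, 0, w), (5, 2, s),
    (2, 0, e), (5, 0, w), (2, 2, n), (0, 3, e), (3, 5, sw), (0, 5, s), (2, 5, w), (0, 2, n),
    (0, 5, s)],
   [(5, 5, w), (2, 5, e), (0, 3, ne), (1, 2, n), (1, 0, n), (3, 3, sw), (5, 3, w), (5, 1, n),
    (5, 4, s), (0, 2, e), (3, 0, w), (0, 5, s), (1, 5, e), (3, 5, sw), (5, 0, w), (3, 2, w),
    (5, 2, w), (4, 5, s)],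
   [(2, 0, e), (5, 2, sw), (2, 1, e), (3, 3, s), (5, 5, sw), (5, 4, s), (5, 1, n), (3, 0, n),
    (5, 3, sw), (5, 0, w), (2, 3, s), (0, 3, e), (3, 5, sw), (0, 5, s), (2, 5, w), (0, 2, n),
    (0, 5, s)],
   [(4, 3, s), (2, 3, e), (0, 3, e), (2, 2, e), (3, 0, n), (5, 3, sw), (5, 0, w), (5, 2, s),
    (5, 5, s), (5, 3, w), (2, 0, e), (0, 5, s), (3, 5, sw), (0, 2, ne), (1, 5, e), (3, 5, sw),
    (5, 0, w), (4, 5, s)],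
   [(2, 2, e), (2, 4, s), (4, 5, sw), (5, 4, w), (3, 0, n), (5, 3, sw), (5, 0, w), (5, 2, s),
    (2, 0, e), (5, 0, w), (2, 2, n), (0, 3, e), (3, 5, sw), (0, 5, s), (2, 5, w), (0, 2, n),
    (0, 5, s)],
   [(2, 1, ne), (3, 0, n), (3, 3, s), (5, 5, sw), (5, 0, w), (5, 2, s), (5, 4, s), (5, 2, w),
    (2, 0, e), (5, 0, w), (2, 3, s), (0, 3, e), (3, 5, sw), (0, 5, s), (2, 5, w), (0, 2, n),
    (0, 5, s)],
   [(4, 2, n), (2, 3, e), (0, 3, e), (2, 2, e), (3, 0, n), (5, 3, sw), (5, 0, w), (5, 2, s),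
    (5, 5, s), (5, 3, w), (2, 0, e), (0, 5, s), (3, 5, sw), (0, 2, ne), (1, 5, e), (3, 5, sw),
    (5, 0, w), (4, 5, s)],
   [(2, 3, ne), (5, 4, w), (4, 2, n), (2, 2, e), (3, 0, n), (5, 3, sw), (5, 0, w), (5, 2, s),
    (2, 0, e), (5, 0, w), (4, 5, s), (0, 3, e), (3, 5, sw), (0, 5, s), (2, 5, w), (0, 2, n),
    (0, 5, s)],
   [(5, 2, s), (3, 0, ne), (4, 3, s), (2, 3, e), (0, 3, e), (2, 0, ne), (5, 3, sw), (5, 5, s),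
    (5, 3, w), (2, 2, e), (0, 5, s), (3, 5, sw), (0, 2, ne), (1, 5, e), (3, 5, sw), (5, 0, w),
    (5, 2, w), (4, 5, s)],
   [(5, 3, s), (3, 0, ne), (4, 3, s), (4, 5, s), (2, 4, e), (5, 4, w), (5, 0, w), (5, 2, s),
    (2, 0, e), (5, 0, w), (2, 2, n), (0, 3, e), (3, 5, sw), (0, 5, s), (2, 5, w), (0, 2, n),
    (0, 5, s)],
   [(3, 0, ne), (2, 1, e), (3, 3, s), (5, 5, sw), (5, 0, w), (5, 2, s), (5, 4, s), (5, 2, w),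
    (2, 0, e), (5, 0, w), (2, 3, s), (0, 3, e), (3, 5, sw), (0, 5, s), (2, 5, w), (0, 2, n),
    (0, 5, s)],
   [(5, 1, n), (3, 0, ne), (4, 3, s), (2, 3, e), (0, 3, e), (2, 0, ne), (5, 3, sw), (5, 5, s),
    (5, 3, w), (2, 2, e), (0, 5, s), (3, 5, sw), (0, 2, ne), (1, 5, e), (3, 5, sw), (5, 0, w),
    (5, 2, w), (4, 5, s)],
   [(3, 2, ne), (4, 5, s), (2, 4, e), (5, 4, w), (3, 0, n), (5, 3, sw), (5, 0, w), (5, 2, s),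
    (2, 0, e), (5, 0, w), (2, 2, n), (0, 3, e), (3, 5, sw), (0, 5, s), (2, 5, w), (0, 2, n),
    (0, 5, s)],
   [(3, 3, ne), (5, 3, w), (5, 5, s), (2, 1, ne), (3, 0, n), (5, 3, sw), (5, 0, w), (5, 2, s),
    (2, 0, e), (5, 0, w), (2, 3, s), (0, 3, e), (3, 5, sw), (0, 5, s), (2, 5, w), (0, 2, n),
    (0, 5, s)]]

/-- The sweep of length 16 from `(0, 0)` to `(4, 4)`: an Eulerian trail on the holes of `Rhombus 5`
with both coordinates even. -/
def longSweep : (ℤ × ℤ) × List (ℤ × ℤ) :=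
  ((0, 0), [e, e, n, w, w, n, e, e, s, sw, n, n, sw, s, ne, ne])

/-- The moves following the long sweep, if any. They depend only on the class of `v.1 + v.2`
modulo 3. -/
def ending (v : ℤ × ℤ) : List ((ℤ × ℤ) × List (ℤ × ℤ)) :=
  if (v.1 + v.2) % 3 = 0 then [((5, 5), [sw])]
  else if (v.1 + v.2) % 3 = 1 then [((4, 5), [s])]
  else []

/-- A solution for the vacancy `v` on `Rhombus 6`. -/
def solution (v : ℤ × ℤ) : List ((ℤ × ℤ) × List (ℤ × ℤ)) :=
  (openings.getD (code v) []).map (fun j => ((j.1, j.2.1), [j.2.2])) ++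
    longSweep :: ending v

/-- The hole of the last peg of `solution v`. -/
def lastHole (v : ℤ × ℤ) : ℤ × ℤ :=
  if (v.1 + v.2) % 3 = 0 then (3, 3) else if (v.1 + v.2) % 3 = 1 then (4, 3) else (4, 4)

theorem onBoard_lastHole (v : ℤ × ℤ) : OnBoard (lastHole v) := by
  unfold lastHole
  split_ifs <;> decide

theorem maskPlay_solution : ∀ v ∈ Rhombus 6,
    maskPlay ((2 ^ 36 - 1) ^^^ 2 ^ code v) (solution v) = some (2 ^ code (lastHole v)) := by
  decide +kernel

end PegSolitaire

open PegSolitaire in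
/-- For every hole `v` of `Rhombus 6`, there is a solution to the
single-vacancy problem with vacancy `v` (ending with exactly one peg) containing
a move which is a sweep of length 16. -/
theorem rhombus6_any_vacancy_solution_with_16sweep :
    ∀ v ∈ Rhombus 6,
      ∃ (ms : List ((ℤ × ℤ) × List (ℤ × ℤ))) (R : Finset (ℤ × ℤ)),
        Plays (Rhombus 6) ((Rhombus 6).erase v) ms R ∧
        R.card = 1 ∧
        ∃ m ∈ ms, m.2.length = 16 := by
  intro v hv
  have h_plays := plays_of_maskPlay (maskPlay_solution v hv)
  rw [position_full_xor (mem_rhombus_six.1 hv), position_two_pow (onBoard_lastHole v)] at h_plays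
  exact ⟨solution v, _, h_plays, Finset.card_singleton _, longSweep, by simp [solution], rfl⟩
end

section
/- On the board Rhombus(6), in every position every legal move has length at most 16; that is, no single move can capture more than 16 pegs, so 16 is the maximal sweep length on Rhombus(6). -/
/-- The holes that a peg starting at `s` can capture on `Rhombus 6`: those in the `5 × 5` box spanned
by the holes congruent to `s` modulo `2`, other than these holes themselves. -/
noncomputable def capturableHoles (s : ℤ × ℤ) : Finset (ℤ × ℤ) :=
  (Finset.Icc (s.1 % 2) (s.1 % 2 + 4) ×ˢ Finset.Icc (s.2 % 2) (s.2 % 2 + 4)).filter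
    fun q => ¬(q.1 % 2 = s.1 % 2 ∧ q.2 % 2 = s.2 % 2)

theorem card_capturableHoles (s : ℤ × ℤ) : (capturableHoles s).card = 16 := by
  unfold capturableHoles
  rcases Int.emod_two_eq_zero_or_one s.1 with h₁ | h₁ <;>
    rcases Int.emod_two_eq_zero_or_one s.2 with h₂ | h₂ <;>
    rw [h₁, h₂] <;> decide

theorem capturableHoles_add_add (s d : ℤ × ℤ) :
    capturableHoles (s + d + d) = capturableHoles s := by
  have h₁ : (s + d + d).1 % 2 = s.1 % 2 := by simp only [Prod.fst_add]; omega
  have h₂ : (s + d + d).2 % 2 = s.2 % 2 := by simp only [Prod.snd_add]; omega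
  simp only [capturableHoles, h₁, h₂]

theorem add_mem_capturableHoles {s d : ℤ × ℤ} (hd : d ∈ Dirs) (hs : s ∈ Rhombus 6)
    (he : s + d + d ∈ Rhombus 6) : s + d ∈ capturableHoles s := by
  obtain ⟨x, y⟩ := s
  simp only [Dirs, Finset.mem_insert, Finset.mem_singleton] at hd
  rcases hd with rfl | rfl | rfl | rfl | rfl | rfl <;>
    simp only [Rhombus, capturableHoles, Finset.mem_product, Finset.mem_Icc, Finset.mem_filter,
      Prod.mk_add_mk] at * <;> omega

theorem notMem_capturableHoles_self (s : ℤ × ℤ) : s ∉ capturableHoles s := by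
  simp [capturableHoles]

theorem jumpResult_subset {B P : Finset (ℤ × ℤ)} {s d : ℤ × ℤ} (hP : P ⊆ B)
    (h : JumpOK B P s d) : jumpResult P s d ⊆ B :=
  Finset.union_subset (Finset.sdiff_subset.trans hP)
    (Finset.singleton_subset_iff.mpr h.2.2.2.1)

/-- Every jump of a sweep removes a peg from the capturable holes, and none ever returns there. -/
theorem SweepFrom.length_le_card_inter {P Q : Finset (ℤ × ℤ)} {s e : ℤ × ℤ} {ds : List (ℤ × ℤ)}
    (h : SweepFrom (Rhombus 6) P s ds e Q) (hP : P ⊆ Rhombus 6) :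
    ds.length ≤ (P ∩ capturableHoles s).card := by
  induction h with
  | nil => exact Nat.zero_le _
  | @cons P s d e ds Q hj _ ih =>
    have ih' := ih (jumpResult_subset hP hj)
    rw [capturableHoles_add_add] at ih'
    obtain ⟨hd, hs, hm, he, -⟩ := hj
    have hsub : jumpResult P s d ∩ capturableHoles s ⊆
        (P ∩ capturableHoles s).erase (s + d) := by
      intro q hq
      have hne : s + d + d ∉ capturableHoles s := by
        simpa only [capturableHoles_add_add] using notMem_capturableHoles_self (s + d + d)
      simp only [jumpResult, Finset.mem_inter, Finset.mem_union, Finset.mem_sdiff,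
        Finset.mem_insert, Finset.mem_singleton, Finset.mem_erase] at hq ⊢
      rcases hq with ⟨⟨hqP, hq⟩ | rfl, hqM⟩
      · exact ⟨fun h => hq (Or.inr h), hqP, hqM⟩
      · exact absurd hqM hne
    have hmem : s + d ∈ P ∩ capturableHoles s :=
      Finset.mem_inter.mpr ⟨hm, add_mem_capturableHoles hd (hP hs) he⟩
    have hlt := Finset.card_erase_lt_of_mem hmem
    have hle := Finset.card_le_card hsub
    rw [List.length_cons]
    omega

/-- On `Rhombus 6`, every legal move in every position has length at
most 16. -/
theorem rhombus6_max_sweep_16 (P : Finset (ℤ × ℤ)) (hP : P ⊆ Rhombus 6)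
    (s : ℤ × ℤ) (ds : List (ℤ × ℤ)) (e : ℤ × ℤ) (Q : Finset (ℤ × ℤ))
    (h : SweepFrom (Rhombus 6) P s ds e Q) :
    ds.length ≤ 16 := by
  exact (h.length_le_card_inter hP).trans
    ((Finset.card_le_card Finset.inter_subset_right).trans (card_capturableHoles s).le)
end

section
/- For every odd integer n ≥ 3, in every position on the board Rhombus(n) every legal move has length at most (3n+1)(n−1)/4; that is, the super-sweep of length (3n+1)(n−1)/4 is a maximal sweep on Rhombus(n). -/
/-- The captured holes of a sweep on `B` starting at `s` are distinct pegs of `P`, none of them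
lies in the parity class of `s`, and each is the midpoint of two board holes in that class. -/
theorem SweepFrom.exists_captured {B P : Finset (ℤ × ℤ)} {s e : ℤ × ℤ} {ds : List (ℤ × ℤ)}
    {Q : Finset (ℤ × ℤ)} (h : SweepFrom B P s ds e Q) (hP : P ⊆ B) :
    ∃ M ⊆ P, M.card = ds.length ∧ ∀ m ∈ M,
      ¬(m.1 % 2 = s.1 % 2 ∧ m.2 % 2 = s.2 % 2) ∧
      ∃ d, m - d ∈ B ∧ m + d ∈ B ∧
        (m - d).1 % 2 = s.1 % 2 ∧ (m - d).2 % 2 = s.2 % 2 := by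
  induction h with
  | nil P s => exact ⟨∅, by simp⟩
  | @cons P s d e ds Q hj _ ih =>
    obtain ⟨hd, hs, hsd, hB, -⟩ := hj
    have hsub : jumpResult P s d ⊆ B := by
      intro x hx
      simp only [jumpResult, Finset.mem_union, Finset.mem_sdiff, Finset.mem_singleton] at hx
      rcases hx with hx | rfl
      exacts [hP hx.1, hB]
    obtain ⟨M, hMP, hMc, hM⟩ := ih hsub
    have hmod : (s + d + d).1 % 2 = s.1 % 2 ∧ (s + d + d).2 % 2 = s.2 % 2 := by
      simp only [Prod.fst_add, Prod.snd_add]; omega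
    rw [hmod.1, hmod.2] at hM
    have hodd : ¬((s + d).1 % 2 = s.1 % 2 ∧ (s + d).2 % 2 = s.2 % 2) := by
      simp only [Dirs, Finset.mem_insert, Finset.mem_singleton] at hd
      simp only [Prod.fst_add, Prod.snd_add]
      rcases hd with rfl | rfl | rfl | rfl | rfl | rfl <;> dsimp only <;> omega
    have hne : s + d ≠ s + d + d := fun heq => hodd (heq ▸ hmod)
    have hnot : s + d ∉ M := fun hmem => by
      simpa [jumpResult, -left_eq_add, hne] using hMP hmem
    refine ⟨insert (s + d) M, ?_, by simp [hnot, hMc], ?_⟩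
    · refine Finset.insert_subset hsd fun m hm => ?_
      have hmJ := hMP hm
      simp only [jumpResult, Finset.mem_union, Finset.mem_sdiff, Finset.mem_singleton] at hmJ
      rcases hmJ with hmJ | rfl
      exacts [hmJ.1, absurd hmod (hM _ hm).1]
    · intro m hm
      rcases Finset.mem_insert.1 hm with rfl | hm
      · exact ⟨hodd, d, by simpa using hP hs, hB, by simp⟩
      · exact hM m hm

theorem mem_rhombus {n : ℕ} {p : ℤ × ℤ} :
    p ∈ Rhombus n ↔ (0 ≤ p.1 ∧ p.1 ≤ n - 1) ∧ 0 ≤ p.2 ∧ p.2 ≤ n - 1 := by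
  simp [Rhombus, Finset.mem_product]

/-- On a rhombus of odd side `2k+1`, at most `(2k+1)² - (k+1)²` holes are not doubly even. -/
theorem card_add_sq_le_of_not_even {k : ℕ} {M : Finset (ℤ × ℤ)} (hM : M ⊆ Rhombus (2 * k + 1))
    (hodd : ∀ m ∈ M, ¬(m.1 % 2 = 0 ∧ m.2 % 2 = 0)) :
    M.card + (k + 1) ^ 2 ≤ (2 * k + 1) ^ 2 := by
  let E : Finset (ℤ × ℤ) := (Finset.range (k + 1) ×ˢ Finset.range (k + 1)).image
    fun p => (2 * (p.1 : ℤ), 2 * (p.2 : ℤ))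
  have hE : E.card = (k + 1) ^ 2 := by
    rw [Finset.card_image_of_injective, Finset.card_product, Finset.card_range, sq]
    rintro ⟨a, b⟩ ⟨c, d⟩ hab
    simpa using hab
  have hdisj : Disjoint M E := by
    rw [Finset.disjoint_left]
    intro m hm hmE
    obtain ⟨p, -, rfl⟩ := Finset.mem_image.1 hmE
    exact hodd _ hm (by simp)
  have hER : E ⊆ Rhombus (2 * k + 1) := by
    intro m hm
    obtain ⟨p, hp, rfl⟩ := Finset.mem_image.1 hm
    simp only [Finset.mem_product, Finset.mem_range] at hp
    rw [mem_rhombus]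
    push_cast
    omega
  have hR : (Rhombus (2 * k + 1)).card = (2 * k + 1) ^ 2 := by
    simp [Rhombus, Finset.card_product, sq]
    norm_cast
  rw [← hE, ← hR, ← Finset.card_union_of_disjoint hdisj]
  exact Finset.card_le_card (Finset.union_subset hM hER)

/-- For every odd `n ≥ 3`, every legal move in every position on
`Rhombus n` has length at most `(3*n+1)*(n-1)/4`. -/
theorem rhombus_odd_max_sweep (n : ℕ) (hn : 3 ≤ n) (hodd : Odd n)
    (P : Finset (ℤ × ℤ)) (hP : P ⊆ Rhombus n)
    (s : ℤ × ℤ) (ds : List (ℤ × ℤ)) (e : ℤ × ℤ) (Q : Finset (ℤ × ℤ))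
    (h : SweepFrom (Rhombus n) P s ds e Q) :
    ds.length ≤ (3 * n + 1) * (n - 1) / 4 := by
  obtain ⟨k, rfl⟩ := hodd
  obtain ⟨M, -, hcard, hM⟩ := h.exists_captured hP
  have hshift : (M.image fun m => m - (s.1 % 2, s.2 % 2)).card = M.card :=
    Finset.card_image_of_injective _ (sub_left_injective)
  have hle := card_add_sq_le_of_not_even (k := k)
    (M := M.image fun m => m - (s.1 % 2, s.2 % 2)) (by
      intro x hx
      obtain ⟨m, hm, rfl⟩ := Finset.mem_image.1 hx
      obtain ⟨-, d, hsub, hadd, hmod⟩ := hM m hm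
      rw [mem_rhombus] at hsub hadd ⊢
      simp only [Prod.fst_add, Prod.snd_add, Prod.fst_sub, Prod.snd_sub] at hsub hadd hmod ⊢
      omega) (by
      intro x hx
      obtain ⟨m, hm, rfl⟩ := Finset.mem_image.1 hx
      have hpar := (hM m hm).1
      simp only [Prod.fst_sub, Prod.snd_sub]
      omega)
  rw [hshift, hcard] at hle
  rw [Nat.le_div_iff_mul_le (by norm_num), Nat.add_sub_cancel]
  nlinarith
end

section
/- On the board Rhombus(6), the e5-complement problem (vacancy at e5 = (4,4), final peg at e5) has a solution whose last move is a sweep of length 16. -/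
instance (B P : Finset (ℤ × ℤ)) (p d : ℤ × ℤ) : Decidable (JumpOK B P p d) :=
  inferInstanceAs (Decidable (_ ∧ _))

/-- The position after the sweep from `s` in directions `ds`, or `none` if some jump is illegal. -/
def runSweep (B P : Finset (ℤ × ℤ)) (s : ℤ × ℤ) :
    List (ℤ × ℤ) → Option (Finset (ℤ × ℤ))
  | [] => some P
  | d :: ds => if JumpOK B P s d then runSweep B (jumpResult P s d) (s + d + d) ds else none

/-- The position after the moves `ms`, or `none` if some move is illegal. -/
def runMoves (B P : Finset (ℤ × ℤ)) :
    List ((ℤ × ℤ) × List (ℤ × ℤ)) → Option (Finset (ℤ × ℤ))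
  | [] => some P
  | m :: ms => if m.2 = [] then none else (runSweep B P m.1 m.2).bind (runMoves B · ms)

theorem sweepFrom_of_runSweep {B P Q : Finset (ℤ × ℤ)} {s : ℤ × ℤ} {ds : List (ℤ × ℤ)}
    (h : runSweep B P s ds = some Q) : SweepFrom B P s ds (sweepEnd s ds) Q := by
  induction ds generalizing P s with
  | nil => cases h; exact .nil _ _
  | cons d ds ih =>
    rw [runSweep] at h
    split_ifs at h with hj
    exact .cons hj (ih h)

theorem plays_of_runMoves {B P Q : Finset (ℤ × ℤ)} {ms : List ((ℤ × ℤ) × List (ℤ × ℤ))}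
    (h : runMoves B P ms = some Q) : Plays B P ms Q := by
  induction ms generalizing P with
  | nil => cases h; exact .nil _
  | cons m ms ih =>
    rw [runMoves] at h
    split_ifs at h with hm
    obtain ⟨R, hR, hQ⟩ := Option.bind_eq_some_iff.mp h
    exact .cons ⟨hm, _, sweepFrom_of_runSweep hR⟩ (ih hQ)

/-- On `Rhombus 6`, the e5-complement problem (e5 = (4,4)) has a solution
whose last move is a sweep of length 16. -/
theorem rhombus6_e5_complement_final_16sweep :
    ∃ (ms : List ((ℤ × ℤ) × List (ℤ × ℤ))) (m : (ℤ × ℤ) × List (ℤ × ℤ)),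
      Plays (Rhombus 6) ((Rhombus 6).erase ((4 : ℤ), (4 : ℤ))) (ms ++ [m])
        {((4 : ℤ), (4 : ℤ))} ∧
      m.2.length = 16 := by
  refine ⟨
    [((4, 2), [(0, 1)]), ((2, 3), [(1, 0)]), ((0, 3), [(1, 0)]), ((2, 2), [(1, 0)]),
     ((3, 0), [(0, 1)]), ((5, 3), [(-1, -1)]), ((5, 0), [(-1, 0)]), ((5, 2), [(0, -1)]),
     ((5, 5), [(0, -1)]), ((5, 3), [(-1, 0)]), ((2, 0), [(1, 0)]), ((0, 5), [(0, -1)]),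
     ((3, 5), [(-1, -1)]), ((0, 2), [(1, 1)]), ((1, 5), [(1, 0)]), ((3, 5), [(-1, -1)]),
     ((5, 0), [(-1, 0)]), ((4, 5), [(0, -1)])],
    ((0, 0),
     [(1, 0), (1, 0), (0, 1), (-1, 0), (-1, 0), (0, 1), (1, 0), (1, 0),
     (0, -1), (-1, -1), (0, 1), (0, 1), (-1, -1), (0, -1), (1, 1), (1, 1)]),
    plays_of_runMoves ?_, rfl⟩
  decide +kernel
end

section
/- On the board Rhombus(6), the d4-complement problem (vacancy at d4 = (3,3), final peg at d4) has a solution whose second-to-last move is a sweep of length 16. -/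
/-- The position reached by the sweep from `s` with directions `ds`. -/
def sweepResult (P : Finset (ℤ × ℤ)) (s : ℤ × ℤ) : List (ℤ × ℤ) → Finset (ℤ × ℤ)
  | [] => P
  | d :: ds => sweepResult (jumpResult P s d) (s + d + d) ds

/-- Every jump of the sweep from `s` with directions `ds` is legal. -/
def SweepLegal (B P : Finset (ℤ × ℤ)) (s : ℤ × ℤ) : List (ℤ × ℤ) → Prop
  | [] => True
  | d :: ds => JumpOK B P s d ∧ SweepLegal B (jumpResult P s d) (s + d + d) ds

/-- Every move of `ms` is legal when played in order from `P`, and the final position is `R`. -/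
def PlayLegal (B P R : Finset (ℤ × ℤ)) : List ((ℤ × ℤ) × List (ℤ × ℤ)) → Prop
  | [] => P = R
  | m :: ms => m.2 ≠ [] ∧ SweepLegal B P m.1 m.2 ∧ PlayLegal B (sweepResult P m.1 m.2) R ms

instance SweepLegal.decidable (B P : Finset (ℤ × ℤ)) (s : ℤ × ℤ) (ds : List (ℤ × ℤ)) :
    Decidable (SweepLegal B P s ds) :=
  match ds with
  | [] => isTrue trivial
  | d :: ds =>
    have := SweepLegal.decidable B (jumpResult P s d) (s + d + d) ds
    inferInstanceAs (Decidable (_ ∧ _))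

instance PlayLegal.decidable (B P R : Finset (ℤ × ℤ)) (ms : List ((ℤ × ℤ) × List (ℤ × ℤ))) :
    Decidable (PlayLegal B P R ms) :=
  match ms with
  | [] => inferInstanceAs (Decidable (P = R))
  | m :: ms =>
    have := PlayLegal.decidable B (sweepResult P m.1 m.2) R ms
    inferInstanceAs (Decidable (_ ∧ _ ∧ _))

theorem SweepLegal.sweepFrom {B P : Finset (ℤ × ℤ)} {s : ℤ × ℤ} {ds : List (ℤ × ℤ)}
    (h : SweepLegal B P s ds) : SweepFrom B P s ds (sweepEnd s ds) (sweepResult P s ds) := by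
  induction ds generalizing P s with
  | nil => exact .nil P s
  | cons d ds ih => exact .cons h.1 (ih h.2)

theorem PlayLegal.plays {B P R : Finset (ℤ × ℤ)} {ms : List ((ℤ × ℤ) × List (ℤ × ℤ))}
    (h : PlayLegal B P R ms) : Plays B P ms R := by
  induction ms generalizing P with
  | nil => cases h; exact .nil _
  | cons m ms ih => exact .cons ⟨h.1, _, h.2.1.sweepFrom⟩ (ih h.2.2)

/-- Moves, one jump each, from the position with a single vacancy at `d4` to the position that
consists of a1, f6 and every hole midway between two neighbouring holes with even coordinates. -/
def openingMoves : List ((ℤ × ℤ) × List (ℤ × ℤ)) :=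
  [((5, 5), [(-1, -1)]), ((4, 2), [(0, 1)]), ((2, 2), [(1, 0)]),
   ((3, 0), [(0, 1)]), ((5, 3), [(-1, -1)]), ((5, 1), [(0, 1)]),
   ((5, 3), [(0, 1)]), ((5, 0), [(-1, 0)]), ((4, 5), [(0, -1)]),
   ((2, 0), [(0, 1)]), ((2, 3), [(0, -1)]), ((0, 3), [(1, 0)]),
   ((3, 5), [(-1, -1)]), ((0, 5), [(0, -1)]), ((2, 5), [(-1, 0)]),
   ((0, 2), [(0, 1)]), ((0, 5), [(0, -1)])]

/-- Directions of an Eulerian trail from a1 to e5 through the holes with even coordinates. -/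
def eulerianSweep : List (ℤ × ℤ) :=
  [(1, 0), (1, 0), (0, 1), (-1, -1), (0, 1), (-1, -1), (0, 1), (1, 0),
   (1, 0), (0, 1), (-1, -1), (0, 1), (-1, -1), (0, 1), (1, 0), (1, 0)]

/-- On `Rhombus 6`, the d4-complement problem (d4 = (3,3)) has a solution
whose second-to-last move is a sweep of length 16. -/
theorem rhombus6_d4_complement_secondlast_16sweep :
    ∃ (ms : List ((ℤ × ℤ) × List (ℤ × ℤ))) (m₁ m₂ : (ℤ × ℤ) × List (ℤ × ℤ)),
      Plays (Rhombus 6) ((Rhombus 6).erase ((3 : ℤ), (3 : ℤ))) (ms ++ [m₁, m₂])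
        {((3 : ℤ), (3 : ℤ))} ∧
      m₁.2.length = 16 := by
  refine ⟨openingMoves, ((0, 0), eulerianSweep), ((5, 5), [(-1, -1)]), PlayLegal.plays ?_, rfl⟩
  decide +kernel
end
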